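/- Let ∑_{i=1}^k αᵢ sᵢ ≥ 1 with α ∈ ℝ^k, α ≥ 0, be a facet-defining inequality for conv(P(R,f)), and suppose the cone generated by {r¹,…,r^k} equals ℝ². Then f lies in the interior of L_α, and L_α is one of the following: a subset of a split set; a triangle of type T¹; a triangle of type T^{2A}; a triangle of type T^{2B}; a triangle of type T³; a quadrilateral of type Q¹; or a quadrilateral of type Q². -/

import Mathlib

open Set Pointwise

abbrev Pt : Type := Fin 2 → ℝ

def IsIntPt (x : Pt) : Prop := ∀ j, ∃ z : ℤ, x j = (z : ℝ)

def IsRatPt (x : Pt) : Prop := ∀ j, ∃ q : ℚ, x j = (q : ℝ)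

/-- The mixed-integer set `P(R,f)`. -/
def mixedP (k : ℕ) (r : Fin k → Pt) (f : Pt) : Set (Pt × (Fin k → ℝ)) :=
  {p | IsIntPt p.1 ∧ (∀ i, 0 ≤ p.2 i) ∧ p.1 = f + ∑ i, p.2 i • r i}

/-- The linear relaxation `P(R,f)⁰`. -/
def relaxP (k : ℕ) (r : Fin k → Pt) (f : Pt) : Set (Pt × (Fin k → ℝ)) :=
  {p | (∀ i, 0 ≤ p.2 i) ∧ p.1 = f + ∑ i, p.2 i • r i}

/-- The convex cone generated by a set (all nonnegative combinations). -/
def coneGen (S : Set Pt) : Set Pt :=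
  {x | ∃ (n : ℕ) (c : Fin n → ℝ) (v : Fin n → Pt),
    (∀ j, 0 ≤ c j) ∧ (∀ j, v j ∈ S) ∧ x = ∑ j, c j • v j}

/-- The induced lattice-free set `L_α`. -/
def inducedSet (k : ℕ) (r : Fin k → Pt) (f : Pt) (α : Fin k → ℝ) : Set Pt :=
  convexHull ℝ ({f} ∪ {x | ∃ i, 0 < α i ∧ x = f + (α i)⁻¹ • r i}) +
    coneGen {x | ∃ i, α i = 0 ∧ x = r i}

def LatticeFree (S : Set Pt) : Prop := ∀ x ∈ interior S, ¬ IsIntPt x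

/-- Validity of `∑ αᵢ sᵢ ≥ γ` for `conv(P(R,f))`. -/
def ValidIneq (k : ℕ) (r : Fin k → Pt) (f : Pt) (α : Fin k → ℝ) (γ : ℝ) : Prop :=
  ∀ p ∈ mixedP k r f, γ ≤ ∑ i, α i * p.2 i

noncomputable def affDim {V : Type*} [AddCommGroup V] [Module ℝ V] (S : Set V) : ℕ :=
  Module.finrank ℝ (affineSpan ℝ S).direction

/-- Facet-defining inequality: valid and its face of the closed convex hull has
affine dimension exactly one less. -/
def IsFacet (k : ℕ) (r : Fin k → Pt) (f : Pt) (α : Fin k → ℝ) (γ : ℝ) : Prop :=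
  ValidIneq k r f α γ ∧
  affDim {p ∈ closure (convexHull ℝ (mixedP k r f)) | ∑ i, α i * p.2 i = γ} + 1 =
    affDim (convexHull ℝ (mixedP k r f))

def splitClosure (k : ℕ) (C : Set (Pt × (Fin k → ℝ))) : Set (Pt × (Fin k → ℝ)) :=
  ⋂ (π : Fin 2 → ℤ) (π₀ : ℤ),
    convexHull ℝ ((C ∩ {p | ∑ j, (π j : ℝ) * p.1 j ≤ (π₀ : ℝ)}) ∪
      (C ∩ {p | (π₀ : ℝ) + 1 ≤ ∑ j, (π j : ℝ) * p.1 j}))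

def closures (k : ℕ) (r : Fin k → Pt) (f : Pt) : ℕ → Set (Pt × (Fin k → ℝ))
  | 0 => relaxP k r f
  | n + 1 => splitClosure k (closures k r f n)

/-- The split rank of `∑ αᵢ sᵢ ≥ γ` w.r.t. `P(R,f)⁰`: least `j` such that the
inequality is valid on the `j`-th split closure, `⊤` if none exists. -/
noncomputable def splitRank (k : ℕ) (r : Fin k → Pt) (f : Pt) (α : Fin k → ℝ) (γ : ℝ) : ℕ∞ :=
  sInf {j : ℕ∞ | ∃ n : ℕ, j = (n : ℕ∞) ∧ ∀ p ∈ closures k r f n, γ ≤ ∑ i, α i * p.2 i}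

def IsSplitSet (S : Set Pt) : Prop :=
  ∃ (π : Fin 2 → ℤ) (π₀ : ℤ), π ≠ 0 ∧
    S = {x : Pt | (π₀ : ℝ) ≤ ∑ j, (π j : ℝ) * x j ∧ ∑ j, (π j : ℝ) * x j ≤ (π₀ : ℝ) + 1}

/-- Triangle of type `T¹`. -/
def IsT1 (S : Set Pt) : Prop :=
  ∃ v : Fin 3 → Pt, AffineIndependent ℝ v ∧ (∀ i, IsIntPt (v i)) ∧
    S = convexHull ℝ (Set.range v) ∧
    ∀ i j, i ≠ j → ∃! z, z ∈ openSegment ℝ (v i) (v j) ∧ IsIntPt z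

/-- Triangle of type `T^{2A}`. -/
def IsT2A (S : Set Pt) : Prop :=
  ∃ v0 v1 v2 : Pt, AffineIndependent ℝ ![v0, v1, v2] ∧ ¬ IsIntPt v0 ∧
    S = convexHull ℝ {v0, v1, v2} ∧
    (∃ z1 z2 : Pt, z1 ≠ z2 ∧ IsIntPt z1 ∧ IsIntPt z2 ∧
      z1 ∈ segment ℝ v1 v2 ∧ z2 ∈ segment ℝ v1 v2) ∧
    (∃! z, z ∈ openSegment ℝ v0 v1 ∧ IsIntPt z) ∧
    (∃! z, z ∈ openSegment ℝ v0 v2 ∧ IsIntPt z)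

/-- Triangle of type `T^{2B}`. -/
def IsT2B (S : Set Pt) : Prop :=
  ∃ v0 v1 v2 : Pt, AffineIndependent ℝ ![v0, v1, v2] ∧ ¬ IsIntPt v0 ∧
    S = convexHull ℝ {v0, v1, v2} ∧
    (∃ z1 z2 : Pt, z1 ≠ z2 ∧ IsIntPt z1 ∧ IsIntPt z2 ∧
      z1 ∈ segment ℝ v1 v2 ∧ z2 ∈ segment ℝ v1 v2) ∧
    (∃! z, z ∈ openSegment ℝ v0 v1 ∧ IsIntPt z) ∧
    (∀ z ∈ openSegment ℝ v0 v2, ¬ IsIntPt z)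

/-- Triangle of type `T³`. -/
def IsT3 (S : Set Pt) : Prop :=
  ∃ v0 v1 v2 : Pt, AffineIndependent ℝ ![v0, v1, v2] ∧
    ¬ IsIntPt v0 ∧ ¬ IsIntPt v1 ∧ ¬ IsIntPt v2 ∧
    S = convexHull ℝ {v0, v1, v2} ∧
    (∃! z, z ∈ openSegment ℝ v0 v1 ∧ IsIntPt z) ∧
    (∃! z, z ∈ openSegment ℝ v1 v2 ∧ IsIntPt z) ∧
    (∃! z, z ∈ openSegment ℝ v0 v2 ∧ IsIntPt z) ∧
    (∀ z, IsIntPt z → z ∈ frontier S →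
      z ∈ openSegment ℝ v0 v1 ∨ z ∈ openSegment ℝ v1 v2 ∨ z ∈ openSegment ℝ v0 v2)

/-- A quadrilateral with vertices `v 0, v 1, v 2, v 3` in cyclic order; each `vᵢ`
is an extreme point of the hull and each side lies on the boundary. -/
def IsQuadWith (S : Set Pt) (v : Fin 4 → Pt) : Prop :=
  S = convexHull ℝ (Set.range v) ∧
  (∀ i, v i ∈ Set.extremePoints ℝ S) ∧
  (∀ i : Fin 4, segment ℝ (v i) (v (i + 1)) ⊆ frontier S)

/-- Quadrilateral of type `Q¹`. -/
def IsQ1 (S : Set Pt) : Prop :=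
  ∃ v : Fin 4 → Pt, IsQuadWith S v ∧
    (∃ z1 z2 : Pt, z1 ≠ z2 ∧ IsIntPt z1 ∧ IsIntPt z2 ∧
      z1 ∈ segment ℝ (v 0) (v 1) ∧ z2 ∈ segment ℝ (v 0) (v 1)) ∧
    (∃ j : Fin 4, j ≠ 0 ∧
      (∀ i : Fin 4, i ≠ 0 → i ≠ j → ∃ z, IsIntPt z ∧ z ∈ segment ℝ (v i) (v (i + 1))) ∧
      (∀ z ∈ openSegment ℝ (v j) (v (j + 1)), ¬ IsIntPt z)) ∧
    (∃ T : Set Pt, (IsT1 T ∨ IsT2A T) ∧ S ⊆ T)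

/-- Quadrilateral of type `Q²`. -/
def IsQ2 (S : Set Pt) : Prop :=
  ∃ v : Fin 4 → Pt, IsQuadWith S v ∧ (∀ i, ¬ IsIntPt (v i)) ∧
    ∀ i : Fin 4, ∃! z, z ∈ openSegment ℝ (v i) (v (i + 1)) ∧ IsIntPt z

/-! ### The induced set -/

theorem mem_coneGen_index_iff {k : ℕ} {r : Fin k → Pt} {p : Fin k → Prop} {x : Pt} :
    x ∈ coneGen {x | ∃ i, p i ∧ x = r i} ↔
      ∃ s : Fin k → ℝ, (∀ i, 0 ≤ s i) ∧ (∀ i, ¬ p i → s i = 0) ∧ x = ∑ i, s i • r i := by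
  classical
  constructor
  · rintro ⟨n, c, v, hc, hv, rfl⟩
    choose φ hφ hv using hv
    refine ⟨fun i => ∑ j, if φ j = i then c j else 0, ?_, ?_, ?_⟩
    · intro i
      exact Finset.sum_nonneg fun j _ => by split_ifs <;> simp [hc]
    · intro i hi
      refine Finset.sum_eq_zero fun j _ => ?_
      rw [if_neg]
      rintro rfl
      exact hi (hφ j)
    · simp_rw [Finset.sum_smul]
      rw [Finset.sum_comm]
      refine Finset.sum_congr rfl fun j _ => ?_
      simp [ite_smul, ← hv j]
  · rintro ⟨s, h0, hp, rfl⟩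
    by_cases hex : ∃ i, p i
    · obtain ⟨i0, hi0⟩ := hex
      refine ⟨k, s, fun i => if p i then r i else r i0, h0, ?_, ?_⟩
      · intro j
        by_cases hj : p j
        · exact ⟨j, hj, by simp [hj]⟩
        · exact ⟨i0, hi0, by simp [hj]⟩
      · refine Finset.sum_congr rfl fun i _ => ?_
        by_cases hi : p i
        · simp [hi]
        · simp [hp i hi]
    · push Not at hex
      refine ⟨0, 0, 0, by simp, by simp, ?_⟩
      simp [fun i => hp i (hex i)]

theorem exists_nonneg_repr_of_coneGen {k : ℕ} {r : Fin k → Pt}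
    (hcone : coneGen (Set.range r) = Set.univ) (u : Pt) :
    ∃ s : Fin k → ℝ, (∀ i, 0 ≤ s i) ∧ u = ∑ i, s i • r i := by
  have hu : u ∈ coneGen {x | ∃ i, True ∧ x = r i} := by
    have : {x | ∃ i, True ∧ x = r i} = Set.range r := by ext; simp [eq_comm]
    rw [this, hcone]; trivial
  obtain ⟨s, h0, -, h⟩ := mem_coneGen_index_iff.1 hu
  exact ⟨s, h0, h⟩

theorem mem_inducedSet_iff {k : ℕ} {r : Fin k → Pt} {f : Pt} {α : Fin k → ℝ}
    (hα : ∀ i, 0 ≤ α i) {x : Pt} :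
    x ∈ inducedSet k r f α ↔
      ∃ s : Fin k → ℝ, (∀ i, 0 ≤ s i) ∧ ∑ i, α i * s i ≤ 1 ∧ x = f + ∑ i, s i • r i := by
  classical
  constructor
  · intro hx
    obtain ⟨y, hy, z, hz, rfl⟩ := Set.mem_add.1 hx
    obtain ⟨t, ht0, htp, rfl⟩ := mem_coneGen_index_iff.1 hz
    have hconv : Convex ℝ {y | ∃ s : Fin k → ℝ, (∀ i, 0 ≤ s i) ∧ ∑ i, α i * s i ≤ 1 ∧
        y = f + ∑ i, s i • r i} := by
      rintro _ ⟨s, h0, h1, rfl⟩ _ ⟨s', h0', h1', rfl⟩ a b ha hb hab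
      refine ⟨fun i => a * s i + b * s' i,
        fun i => by have := h0 i; have := h0' i; positivity, ?_, ?_⟩
      · have : ∑ i, α i * (a * s i + b * s' i)
            = a * ∑ i, α i * s i + b * ∑ i, α i * s' i := by
          rw [Finset.mul_sum, Finset.mul_sum, ← Finset.sum_add_distrib]
          exact Finset.sum_congr rfl fun i _ => by ring
        rw [this]
        nlinarith
      · simp only [smul_add, Finset.smul_sum, smul_smul, add_smul, Finset.sum_add_distrib]
        have : f = a • f + b • f := by rw [← add_smul, hab, one_smul]
        nth_rewrite 3 [this]
        abel
    have hsub : convexHull ℝ ({f} ∪ {x | ∃ i, 0 < α i ∧ x = f + (α i)⁻¹ • r i}) ⊆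
        {y | ∃ s : Fin k → ℝ, (∀ i, 0 ≤ s i) ∧ ∑ i, α i * s i ≤ 1 ∧
          y = f + ∑ i, s i • r i} := by
      refine convexHull_min ?_ hconv
      rintro y (rfl | ⟨i, hi, rfl⟩)
      · exact ⟨0, by simp, by simp, by simp⟩
      · refine ⟨Pi.single i (α i)⁻¹, fun j => ?_, ?_, ?_⟩
        · by_cases h : j = i
          · subst h; simp [hi.le]
          · simp [h]
        · rw [Finset.sum_eq_single i] <;> simp +contextual [hi.ne']
        · rw [Finset.sum_eq_single i] <;> simp +contextual
    obtain ⟨s, h0, h1, rfl⟩ := hsub hy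
    refine ⟨s + t, fun i => add_nonneg (h0 i) (ht0 i), ?_, ?_⟩
    · have : ∑ i, α i * (s + t) i = ∑ i, α i * s i := by
        refine Finset.sum_congr rfl fun i _ => ?_
        by_cases hi : α i = 0
        · simp [hi]
        · simp [htp i hi]
      rwa [this]
    · simp [add_smul, Finset.sum_add_distrib, add_assoc]
  · rintro ⟨s, h0, h1, rfl⟩
    refine Set.mem_add.2 ⟨f + ∑ i, (if α i = 0 then 0 else s i) • r i, ?_,
      ∑ i, (if α i = 0 then s i else 0) • r i,
      mem_coneGen_index_iff.2 ⟨_, fun i => ?_, fun i hi => ?_, rfl⟩, ?_⟩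
    · set C := convexHull ℝ ({f} ∪ {x | ∃ i, 0 < α i ∧ x = f + (α i)⁻¹ • r i})
      have hC : Convex ℝ C := convex_convexHull _ _
      have hfC : f ∈ C := subset_convexHull _ _ (Or.inl rfl)
      let z : Option (Fin k) → Pt := fun o =>
        o.elim f fun i => if α i = 0 then f else f + (α i)⁻¹ • r i
      let w : Option (Fin k) → ℝ := fun o => o.elim (1 - ∑ i, α i * s i) fun i => α i * s i
      have := hC.sum_mem (t := Finset.univ) (w := w) (z := z) ?_ ?_ ?_
      · convert this using 1
        simp only [Fintype.sum_option, w, z, Option.elim_none, Option.elim_some]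
        have h2 : ∀ i, (α i * s i) • (if α i = 0 then f else f + (α i)⁻¹ • r i)
            = (α i * s i) • f + (if α i = 0 then 0 else s i) • r i := by
          intro i
          split_ifs with h
          · simp
          · rw [smul_add, smul_smul]
            congr 2
            field_simp
        simp_rw [h2]
        rw [Finset.sum_add_distrib, ← Finset.sum_smul, ← add_assoc, ← add_smul]
        simp
      · rintro (_ | i) -
        · simp [w, h1]
        · exact mul_nonneg (hα i) (h0 i)
      · simp [w]
      · rintro (_ | i) -
        · exact hfC
        · simp only [z, Option.elim_some]
          split_ifs with h
          · exact hfC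
          · exact subset_convexHull _ _ (Or.inr ⟨i, lt_of_le_of_ne (hα i) (Ne.symm h), rfl⟩)
    · split_ifs <;> simp [h0]
    · simp [hi]
    · rw [add_assoc, ← Finset.sum_add_distrib]
      congr 1
      refine Finset.sum_congr rfl fun i _ => ?_
      split_ifs <;> simp

theorem convex_inducedSet (k : ℕ) (r : Fin k → Pt) (f : Pt) (α : Fin k → ℝ) :
    Convex ℝ (inducedSet k r f α) := by
  refine (convex_convexHull _ _).add ?_
  rintro _ hx _ hy a b ha hb hab
  have e : ∀ z, z ∈ coneGen {x | ∃ i, α i = 0 ∧ x = r i} ↔ _ :=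
    fun z => mem_coneGen_index_iff (p := fun i => α i = 0) (r := r) (x := z)
  rw [e] at hx hy ⊢
  obtain ⟨s, h0, hp, rfl⟩ := hx
  obtain ⟨t, h0', hp', rfl⟩ := hy
  refine ⟨fun i => a * s i + b * t i,
    fun i => by have := h0 i; have := h0' i; positivity, fun i hi => ?_, ?_⟩
  · simp [hp i hi, hp' i hi]
  · simp only [Finset.smul_sum, smul_smul, add_smul, Finset.sum_add_distrib]

theorem exists_pos_add_smul_mem_inducedSet {k : ℕ} {r : Fin k → Pt} {f : Pt} {α : Fin k → ℝ}
    (hα : ∀ i, 0 ≤ α i) (hcone : coneGen (Set.range r) = Set.univ) (u : Pt) :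
    ∃ t : ℝ, 0 < t ∧ ∀ τ : ℝ, 0 ≤ τ → τ ≤ t → f + τ • u ∈ inducedSet k r f α := by
  obtain ⟨s, h0, rfl⟩ := exists_nonneg_repr_of_coneGen hcone u
  have hs : 0 ≤ ∑ i, α i * s i := Finset.sum_nonneg fun i _ => mul_nonneg (hα i) (h0 i)
  refine ⟨(1 + ∑ i, α i * s i)⁻¹, by positivity, fun τ h1 h2 => ?_⟩
  rw [mem_inducedSet_iff hα]
  refine ⟨fun i => τ * s i, fun i => mul_nonneg h1 (h0 i), ?_, ?_⟩
  · have : ∑ i, α i * (τ * s i) = τ * ∑ i, α i * s i := by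
      rw [Finset.mul_sum]; exact Finset.sum_congr rfl fun i _ => by ring
    rw [this]
    have h3 : τ * (1 + ∑ i, α i * s i) ≤ 1 := by
      calc _ ≤ (1 + ∑ i, α i * s i)⁻¹ * (1 + ∑ i, α i * s i) := by gcongr
        _ = 1 := inv_mul_cancel₀ (by positivity)
    nlinarith
  · simp [Finset.smul_sum, smul_smul]

theorem mem_interior_inducedSet {k : ℕ} {r : Fin k → Pt} {f : Pt} {α : Fin k → ℝ}
    (hα : ∀ i, 0 ≤ α i) (hcone : coneGen (Set.range r) = Set.univ) :
    f ∈ interior (inducedSet k r f α) := by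
  have hL := convex_inducedSet k r f α
  set L := inducedSet k r f α
  obtain ⟨t1, p1, h1⟩ := exists_pos_add_smul_mem_inducedSet (f := f) hα hcone ![1, 0]
  obtain ⟨t2, p2, h2⟩ := exists_pos_add_smul_mem_inducedSet (f := f) hα hcone ![-1, 0]
  obtain ⟨t3, p3, h3⟩ := exists_pos_add_smul_mem_inducedSet (f := f) hα hcone ![0, 1]
  obtain ⟨t4, p4, h4⟩ := exists_pos_add_smul_mem_inducedSet (f := f) hα hcone ![0, -1]
  have key : ∀ (u : Pt) (t t' : ℝ),
      (∀ τ : ℝ, 0 ≤ τ → τ ≤ t → f + τ • u ∈ L) → (∀ τ : ℝ, 0 ≤ τ → τ ≤ t' → f + τ • (-u) ∈ L) →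
      ∀ τ : ℝ, |τ| ≤ t → |τ| ≤ t' → f + τ • u ∈ L := by
    intro u t t' h h' τ a b
    rcases le_total 0 τ with hτ | hτ
    · rw [abs_of_nonneg hτ] at a b
      exact h τ hτ a
    · rw [abs_of_nonpos hτ] at a b
      have := h' (-τ) (by linarith) b
      simpa using this
  have e1 : (![-1, 0] : Pt) = -![1, 0] := by ext i; fin_cases i <;> simp
  have e2 : (![0, -1] : Pt) = -![0, 1] := by ext i; fin_cases i <;> simp
  rw [e1] at h2
  rw [e2] at h4
  have k1 := key _ _ _ h1 h2
  have k2 := key _ _ _ h3 h4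
  rw [mem_interior_iff_mem_nhds, Metric.mem_nhds_iff]
  refine ⟨min (min t1 t2) (min t3 t4) / 2, by positivity, fun y hy => ?_⟩
  rw [Metric.mem_ball, dist_pi_lt_iff (by positivity)] at hy
  have y0 := hy 0
  have y1 := hy 1
  rw [Real.dist_eq] at y0 y1
  have m1 : min (min t1 t2) (min t3 t4) ≤ t1 := (min_le_left _ _).trans (min_le_left _ _)
  have m2 : min (min t1 t2) (min t3 t4) ≤ t2 := (min_le_left _ _).trans (min_le_right _ _)
  have m3 : min (min t1 t2) (min t3 t4) ≤ t3 := (min_le_right _ _).trans (min_le_left _ _)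
  have m4 : min (min t1 t2) (min t3 t4) ≤ t4 := (min_le_right _ _).trans (min_le_right _ _)
  have a0 : |2 * (y 0 - f 0)| = 2 * |y 0 - f 0| := by rw [abs_mul]; simp
  have a1 : |2 * (y 1 - f 1)| = 2 * |y 1 - f 1| := by rw [abs_mul]; simp
  have q1 := k1 (2 * (y 0 - f 0)) (by rw [a0]; linarith) (by rw [a0]; linarith)
  have q2 := k2 (2 * (y 1 - f 1)) (by rw [a1]; linarith) (by rw [a1]; linarith)
  have := hL q1 q2 (a := 1 / 2) (b := 1 / 2) (by norm_num) (by norm_num) (by norm_num)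
  convert this using 1
  ext i
  fin_cases i <;> simp [Matrix.vecHead, Matrix.vecTail] <;> ring

theorem not_isIntPt_of_mem_interior_inducedSet {k : ℕ} {r : Fin k → Pt} {f : Pt}
    {α : Fin k → ℝ} (hα : ∀ i, 0 ≤ α i) (hvalid : ValidIneq k r f α 1) {x : Pt}
    (hx : x ∈ interior (inducedSet k r f α)) : ¬ IsIntPt x := by
  intro hInt
  have hc : Filter.Tendsto (fun ε : ℝ => f + (1 + ε) • (x - f)) (nhdsWithin 0 (Set.Ioi 0))
      (nhds x) := by
    have : Continuous fun ε : ℝ => f + (1 + ε) • (x - f) := by fun_prop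
    have h2 := (this.tendsto 0).mono_left (nhdsWithin_le_nhds (s := Set.Ioi 0))
    simpa using h2
  have h1 := hc.eventually (mem_interior_iff_mem_nhds.1 hx)
  obtain ⟨ε, hε, hpos⟩ := (h1.and self_mem_nhdsWithin).exists
  have hpos : (0 : ℝ) < ε := hpos
  obtain ⟨s, h0, hs, he⟩ := (mem_inducedSet_iff hα).1 hε
  have he : (1 + ε) • (x - f) = ∑ i, s i • r i := add_left_cancel he
  have hmem : (x, fun i => (1 + ε)⁻¹ * s i) ∈ mixedP k r f := by
    refine ⟨hInt, fun i => mul_nonneg (by positivity) (h0 i), ?_⟩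
    have : ∑ i, ((1 + ε)⁻¹ * s i) • r i = x - f := by
      simp_rw [← smul_smul]
      rw [← Finset.smul_sum, ← he, smul_smul, inv_mul_cancel₀ (by positivity), one_smul]
    simp only [this]
    abel
  have := hvalid _ hmem
  have e : ∑ i, α i * ((1 + ε)⁻¹ * s i) = (1 + ε)⁻¹ * ∑ i, α i * s i := by
    rw [Finset.mul_sum]; exact Finset.sum_congr rfl fun i _ => by ring
  simp only [e] at this
  have h4 : (1 + ε)⁻¹ < 1 := inv_lt_one_of_one_lt₀ (by linarith)
  have h5 : (0 : ℝ) < (1 + ε)⁻¹ := by positivity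
  nlinarith

/-! ### Facets are extremal valid inequalities -/

theorem IsRatPt.exists_nat_smul_isIntPt {x : Pt} (hx : IsRatPt x) :
    ∃ N : ℕ, 0 < N ∧ IsIntPt ((N : ℝ) • x) := by
  obtain ⟨p, hp⟩ := hx 0
  obtain ⟨q, hq⟩ := hx 1
  refine ⟨p.den * q.den, by positivity, fun j => ?_⟩
  have e1 : (p : ℝ) * p.den = p.num := by exact_mod_cast p.mul_den_eq_num
  have e2 : (q : ℝ) * q.den = q.num := by exact_mod_cast q.mul_den_eq_num
  fin_cases j
  · refine ⟨p.num * q.den, ?_⟩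
    simp only [Fin.zero_eta, Pi.smul_apply, hp, smul_eq_mul]
    push_cast
    rw [← e1]; ring
  · refine ⟨q.num * p.den, ?_⟩
    simp only [Fin.mk_one, Pi.smul_apply, hq, smul_eq_mul]
    push_cast
    rw [← e2]; ring

/-- The linear map `z ↦ (R z, z)`. -/
noncomputable def rayGraph {k : ℕ} (r : Fin k → Pt) : (Fin k → ℝ) →ₗ[ℝ] Pt × (Fin k → ℝ) :=
  LinearMap.prod (Fintype.linearCombination ℝ r) LinearMap.id

@[simp]
theorem rayGraph_apply {k : ℕ} (r : Fin k → Pt) (z : Fin k → ℝ) :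
    rayGraph r z = (∑ i, z i • r i, z) := rfl

theorem le_affDim_mixedP {k : ℕ} {r : Fin k → Pt} {f : Pt} (hr_rat : ∀ i, IsRatPt (r i))
    (hne : (mixedP k r f).Nonempty) : k ≤ affDim (convexHull ℝ (mixedP k r f)) := by
  classical
  obtain ⟨⟨x, s⟩, hx, hs, he⟩ := hne
  have hle : LinearMap.range (rayGraph r) ≤
      (affineSpan ℝ (convexHull ℝ (mixedP k r f))).direction := by
    rw [LinearMap.range_eq_map, ← (Pi.basisFun ℝ (Fin k)).span_eq, Submodule.map_span,
      Submodule.span_le]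
    rintro _ ⟨_, ⟨i, rfl⟩, rfl⟩
    obtain ⟨N, hN, hInt⟩ := (hr_rat i).exists_nat_smul_isIntPt
    have h1 : (x, s) ∈ mixedP k r f := ⟨hx, hs, he⟩
    have h2 : (x + (N : ℝ) • r i, s + (N : ℝ) • Pi.single i (1 : ℝ)) ∈ mixedP k r f := by
      refine ⟨fun j => ?_, fun j => ?_, ?_⟩
      · obtain ⟨a, ha⟩ := hx j
        obtain ⟨b, hb⟩ := hInt j
        exact ⟨a + b, by simp only [Pi.add_apply] at *; rw [ha, hb]; push_cast; rfl⟩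
      · have := hs j
        by_cases h : j = i
        · subst h; simp at *; positivity
        · simpa [h] using this
      · simp only [Pi.add_apply, Pi.smul_apply, add_smul, Finset.sum_add_distrib]
        rw [show x = f + ∑ i, s i • r i from he]
        have e : ∑ j, ((N : ℝ) • (Pi.single i (1 : ℝ) : Fin k → ℝ) j) • r j = (N : ℝ) • r i := by
          rw [Finset.sum_eq_single i]
          · simp
          · intro j _ h; simp [h]
          · simp
        rw [e, add_assoc]
    have h3 := AffineSubspace.vsub_mem_direction
      (subset_affineSpan ℝ _ (subset_convexHull ℝ _ h2))
      (subset_affineSpan ℝ _ (subset_convexHull ℝ _ h1))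
    have h4 := Submodule.smul_mem _ ((N : ℝ)⁻¹) h3
    have hN' : (N : ℝ) ≠ 0 := by positivity
    rw [SetLike.mem_coe]
    convert h4 using 1
    ext j
    · rw [Pi.basisFun_apply, rayGraph_apply, Finset.sum_eq_single i]
      · simp [hN']
      · intro j _ h; simp [h]
      · simp
    · simp [hN']
  have hinj : Function.Injective (rayGraph r) := fun a b h => congrArg Prod.snd h
  calc k = Module.finrank ℝ (LinearMap.range (rayGraph r)) := by
        rw [LinearMap.finrank_range_of_inj hinj]; simp
    _ ≤ _ := Submodule.finrank_mono hle

theorem two_le_of_coneGen_eq_univ {k : ℕ} {r : Fin k → Pt}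
    (hcone : coneGen (Set.range r) = Set.univ) : 2 ≤ k := by
  by_contra! h
  interval_cases k
  · obtain ⟨s, -, h⟩ := exists_nonneg_repr_of_coneGen hcone ![1, 0]
    have := congrFun h 0
    simp at this
  · by_cases hr : r 0 = 0
    · obtain ⟨s, -, h⟩ := exists_nonneg_repr_of_coneGen hcone ![1, 0]
      have := congrFun h 0
      simp [hr] at this
    · obtain ⟨s, -, h⟩ := exists_nonneg_repr_of_coneGen hcone ![- r 0 1, r 0 0]
      have h0 := congrFun h 0
      have h1 := congrFun h 1
      simp at h0 h1
      apply hr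
      have : r 0 0 ^ 2 + r 0 1 ^ 2 = 0 := by
        linear_combination (r 0 0) * h1 - (r 0 1) * h0
      have a0 : r 0 0 = 0 := by nlinarith [sq_nonneg (r 0 0), sq_nonneg (r 0 1)]
      have a1 : r 0 1 = 0 := by nlinarith [sq_nonneg (r 0 0), sq_nonneg (r 0 1)]
      ext j; fin_cases j <;> simp [a0, a1]

/-- The linear functional `s ↦ ∑ αᵢ sᵢ`. -/
noncomputable def dotFunctional {k : ℕ} (α : Fin k → ℝ) : (Fin k → ℝ) →ₗ[ℝ] ℝ :=
  Fintype.linearCombination ℝ α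

theorem dotFunctional_apply {k : ℕ} (α s : Fin k → ℝ) :
    dotFunctional α s = ∑ i, α i * s i := by
  simp [dotFunctional, Fintype.linearCombination_apply, mul_comm]

theorem closure_convexHull_mixedP_subset {k : ℕ} {r : Fin k → Pt} {f : Pt} :
    closure (convexHull ℝ (mixedP k r f)) ⊆ {p | p.1 = f + ∑ i, p.2 i • r i} := by
  refine closure_minimal (convexHull_min (fun p hp => hp.2.2) ?_) ?_
  · rintro ⟨x, s⟩ hx ⟨y, t⟩ hy a b ha hb hab
    simp only [Set.mem_ofPred_eq, Prod.fst_add, Prod.smul_fst, Prod.snd_add, Prod.smul_snd,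
      Pi.add_apply, Pi.smul_apply, smul_eq_mul, add_smul, Finset.sum_add_distrib] at *
    rw [hx, hy]
    simp only [smul_add, Finset.smul_sum, smul_smul]
    have : f = a • f + b • f := by rw [← add_smul, hab, one_smul]
    nth_rewrite 3 [this]
    abel
  · exact isClosed_eq continuous_fst (by fun_prop)

theorem ValidIneq.closure_convexHull {k : ℕ} {r : Fin k → Pt} {f : Pt} {β : Fin k → ℝ} {γ : ℝ}
    (h : ValidIneq k r f β γ) {p} (hp : p ∈ closure (convexHull ℝ (mixedP k r f))) :
    γ ≤ ∑ i, β i * p.2 i := by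
  have : closure (convexHull ℝ (mixedP k r f)) ⊆ {p | γ ≤ ∑ i, β i * p.2 i} := by
    refine closure_minimal (convexHull_min h ?_) ?_
    · rintro ⟨x, s⟩ hx ⟨y, t⟩ hy a b ha hb hab
      simp only [Set.mem_ofPred_eq, ← dotFunctional_apply] at *
      simp only [Prod.snd_add, Prod.smul_snd, map_add, map_smul, smul_eq_mul]
      have : γ = a * γ + b * γ := by rw [← add_mul, hab, one_mul]
      rw [this]
      gcongr
    · exact isClosed_le continuous_const (by fun_prop)
  exact this hp

theorem IsFacet.eq_zero_of_valid_add_sub {k : ℕ} {r : Fin k → Pt} {f : Pt} {α δ : Fin k → ℝ}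
    (hr_rat : ∀ i, IsRatPt (r i)) (hne : (mixedP k r f).Nonempty)
    (hcone : coneGen (Set.range r) = Set.univ) (hfacet : IsFacet k r f α 1)
    (h1 : ValidIneq k r f (α + δ) 1) (h2 : ValidIneq k r f (α - δ) 1) : δ = 0 := by
  classical
  by_contra hδ
  set F := {p ∈ closure (convexHull ℝ (mixedP k r f)) | ∑ i, α i * p.2 i = 1} with hF
  have hk := le_affDim_mixedP hr_rat hne
  have hk2 := two_le_of_coneGen_eq_univ hcone
  have hdim : affDim F + 1 = affDim (convexHull ℝ (mixedP k r f)) := hfacet.2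
  have hFδ : ∀ p ∈ F, dotFunctional δ p.2 = 0 := by
    rintro p ⟨hp, he⟩
    have a := h1.closure_convexHull hp
    have b := h2.closure_convexHull hp
    simp only [← dotFunctional_apply] at *
    have e1 : dotFunctional (α + δ) p.2 = dotFunctional α p.2 + dotFunctional δ p.2 := by
      simp [dotFunctional_apply, add_mul, Finset.sum_add_distrib]
    have e2 : dotFunctional (α - δ) p.2 = dotFunctional α p.2 - dotFunctional δ p.2 := by
      simp [dotFunctional_apply, sub_mul]
    linarith
  rcases F.eq_empty_or_nonempty with hemp | ⟨p, hp⟩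
  · have : affDim F = 0 := by
      rw [hemp]; simp [affDim]
    omega
  · have hα1 : dotFunctional α p.2 = 1 := by rw [dotFunctional_apply]; exact hp.2
    have hδ0 := hFδ p hp
    set Kα := LinearMap.ker (dotFunctional α)
    set Kδ := LinearMap.ker (dotFunctional δ)
    obtain ⟨z, hz⟩ : ∃ z, dotFunctional δ z ≠ 0 := by
      obtain ⟨i, hi⟩ := Function.ne_iff.1 hδ
      refine ⟨Pi.single i 1, ?_⟩
      rw [dotFunctional_apply, Finset.sum_eq_single i] <;> simp +contextual
      exact hi
    have lt1 : Kα ⊓ Kδ < Kα := by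
      refine lt_of_le_of_ne inf_le_left fun h => ?_
      have : z - dotFunctional α z • p.2 ∈ Kα := by
        simp [Kα, LinearMap.mem_ker, hα1]
      rw [← h] at this
      have := this.2
      simp [Kδ, LinearMap.mem_ker, hδ0] at this
      exact hz this
    have lt2 : Kα ≠ ⊤ := by
      intro h
      have : p.2 ∈ Kα := by rw [h]; trivial
      rw [LinearMap.mem_ker, hα1] at this
      norm_num at this
    have f1 := Submodule.finrank_lt_finrank_of_lt lt1
    have f2 := Submodule.finrank_lt lt2
    have hle : (affineSpan ℝ F).direction ≤ (Kα ⊓ Kδ).map (rayGraph r) := by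
      rw [direction_affineSpan, vectorSpan_def, Submodule.span_le]
      rintro _ ⟨a, ha, b, hb, rfl⟩
      refine ⟨a.2 - b.2, ⟨?_, ?_⟩, ?_⟩
      · have e1 : dotFunctional α a.2 = 1 := by rw [dotFunctional_apply]; exact ha.2
        have e2 : dotFunctional α b.2 = 1 := by rw [dotFunctional_apply]; exact hb.2
        simp [Kα, LinearMap.mem_ker, e1, e2]
      · simp [Kδ, LinearMap.mem_ker, hFδ a ha, hFδ b hb]
      · have e1 := closure_convexHull_mixedP_subset ha.1
        have e2 := closure_convexHull_mixedP_subset hb.1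
        simp only [Set.mem_ofPred_eq] at e1 e2
        refine Prod.ext ?_ ?_
        · simp only [rayGraph_apply, Pi.sub_apply, sub_smul, Finset.sum_sub_distrib,
            vsub_eq_sub, Prod.fst_sub]
          rw [e1, e2]
          abel
        · simp
    have f3 : affDim F ≤ Module.finrank ℝ (Kα ⊓ Kδ : Submodule ℝ (Fin k → ℝ)) :=
      (Submodule.finrank_mono hle).trans (Submodule.finrank_map_le _ _)
    have f4 : Module.finrank ℝ (Fin k → ℝ) = k := by simp
    omega

/-! ### Perturbing valid inequalities -/

theorem finite_isIntPt_of_abs_le (C : ℝ) :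
    {x : Pt | IsIntPt x ∧ ∀ j, |x j| ≤ C}.Finite := by
  refine ((Set.finite_Icc (fun _ : Fin 2 => -⌈C⌉) (fun _ : Fin 2 => ⌈C⌉)).image
    (fun z j => ((z j : ℤ) : ℝ))).subset ?_
  rintro x ⟨hx, hC⟩
  choose z hz using hx
  refine ⟨z, ⟨fun j => ?_, fun j => ?_⟩, ?_⟩
  · have := (abs_le.1 (hC j)).1
    rw [hz] at this
    have h2 := Int.le_ceil C
    have : (-⌈C⌉ : ℝ) ≤ z j := by linarith
    exact_mod_cast this
  · have := (abs_le.1 (hC j)).2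
    rw [hz] at this
    have h2 := Int.le_ceil C
    have : (z j : ℝ) ≤ ⌈C⌉ := by linarith
    exact_mod_cast this
  · ext j; exact (hz j).symm

/-- The columns in the support of `s` are linearly independent. -/
def IsBasicFor {k : ℕ} (r : Fin k → Pt) (s : Fin k → ℝ) : Prop :=
  ∀ z : Fin k → ℝ, (∀ i, s i = 0 → z i = 0) → ∑ i, z i • r i = 0 → z = 0

theorem exists_isBasicFor_le {k : ℕ} {r : Fin k → Pt} {β : Fin k → ℝ} (hβ : ∀ i, 0 < β i)
    (s : Fin k → ℝ) (hs : ∀ i, 0 ≤ s i) :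
    ∃ s' : Fin k → ℝ, (∀ i, 0 ≤ s' i) ∧ ∑ i, s' i • r i = ∑ i, s i • r i ∧
      ∑ i, β i * s' i ≤ ∑ i, β i * s i ∧ IsBasicFor r s' := by
  classical
  induction hn : (Finset.univ.filter fun i => s i ≠ 0).card using Nat.strong_induction_on
    generalizing s with
  | _ n ih =>
    by_cases hb : IsBasicFor r s
    · exact ⟨s, hs, rfl, le_rfl, hb⟩
    obtain ⟨z, hz0, hzr, hzne, hzβ⟩ : ∃ z : Fin k → ℝ, (∀ i, s i = 0 → z i = 0) ∧
        ∑ i, z i • r i = 0 ∧ z ≠ 0 ∧ ∑ i, β i * z i ≤ 0 := by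
      unfold IsBasicFor at hb
      push Not at hb
      obtain ⟨z, h1, h2, h3⟩ := hb
      rcases le_total (∑ i, β i * z i) 0 with h | h
      · exact ⟨z, h1, h2, h3, h⟩
      · exact ⟨-z, fun i hi => by simp [h1 i hi], by simp [h2], by simpa using h3, by simpa using h⟩
    have hneg : (Finset.univ.filter fun i => z i < 0).Nonempty := by
      by_contra hemp
      have hall : ∀ i, 0 ≤ z i := by
        intro i
        by_contra! hi
        exact hemp ⟨i, by simpa using hi⟩
      obtain ⟨i, hi⟩ := Function.ne_iff.1 hzne
      have : 0 < ∑ i, β i * z i :=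
        Finset.sum_pos' (fun i _ => mul_nonneg (hβ i).le (hall i))
          ⟨i, Finset.mem_univ i, mul_pos (hβ i) (lt_of_le_of_ne (hall i) (Ne.symm hi))⟩
      linarith
    obtain ⟨i0, hi0, hmin⟩ := Finset.exists_min_image _ (fun i => s i / (-z i)) hneg
    have hi0 : z i0 < 0 := by simpa using hi0
    set t := s i0 / (-z i0) with ht
    have ht0 : 0 ≤ t := div_nonneg (hs i0) (by linarith)
    have hs' : ∀ i, 0 ≤ s i + t * z i := by
      intro i
      rcases lt_or_ge (z i) 0 with h | h
      · have := hmin i (by simpa using h)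
        rw [le_div_iff₀ (by linarith)] at this
        linarith
      · have := hs i
        positivity
    have hi0' : s i0 + t * z i0 = 0 := by
      rw [ht, div_neg, neg_mul, div_mul_cancel₀ _ hi0.ne]; ring
    have hlt : (Finset.univ.filter fun i => s i + t * z i ≠ 0).card < n := by
      rw [← hn]
      apply Finset.card_lt_card
      refine Finset.ssubset_iff_of_subset (fun i hi => ?_) |>.2 ⟨i0, ?_, ?_⟩
      · simp only [Finset.mem_filter, Finset.mem_univ, true_and] at hi ⊢
        intro h
        simp [h, hz0 i h] at hi
      · simp only [Finset.mem_filter, Finset.mem_univ, true_and]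
        intro h
        exact hi0.ne (hz0 i0 h)
      · simp [hi0']
    obtain ⟨s', h1, h2, h3, h4⟩ := ih _ hlt (fun i => s i + t * z i) hs' rfl
    refine ⟨s', h1, ?_, ?_, h4⟩
    · rw [h2]
      simp only [add_smul, Finset.sum_add_distrib, ← smul_smul, ← Finset.smul_sum, hzr]
      simp
    · refine h3.trans ?_
      have : ∑ i, β i * (s i + t * z i) = ∑ i, β i * s i + t * ∑ i, β i * z i := by
        rw [Finset.mul_sum, ← Finset.sum_add_distrib]
        exact Finset.sum_congr rfl fun i _ => by ring
      rw [this]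
      nlinarith

theorem finite_basic_solutions {k : ℕ} (r : Fin k → Pt) (f : Pt) {α : Fin k → ℝ}
    (hα : ∀ i, 0 < α i) :
    {s : Fin k → ℝ | (∀ i, 0 ≤ s i) ∧ IsBasicFor r s ∧ IsIntPt (f + ∑ i, s i • r i) ∧
      ∑ i, α i * s i ≤ 2}.Finite := by
  classical
  set B := {s : Fin k → ℝ | (∀ i, 0 ≤ s i) ∧ IsBasicFor r s ∧ IsIntPt (f + ∑ i, s i • r i) ∧
      ∑ i, α i * s i ≤ 2}
  let C : ℝ := ∑ j, (|f j| + ∑ i, 2 / α i * |r i j|)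
  let φ : (Fin k → ℝ) → Pt × Finset (Fin k) :=
    fun s => (f + ∑ i, s i • r i, Finset.univ.filter fun i => s i ≠ 0)
  have hfin : ({x : Pt | IsIntPt x ∧ ∀ j, |x j| ≤ C} ×ˢ
      (Set.univ : Set (Finset (Fin k)))).Finite :=
    (finite_isIntPt_of_abs_le C).prod Set.finite_univ
  refine Set.Finite.of_finite_image (f := φ) (hfin.subset ?_) ?_
  · rintro _ ⟨s, ⟨h0, hb, hInt, h2⟩, rfl⟩
    refine ⟨⟨hInt, fun j => ?_⟩, trivial⟩
    have hsi : ∀ i, s i ≤ 2 / α i := by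
      intro i
      rw [le_div_iff₀ (hα i), mul_comm]
      refine le_trans ?_ h2
      exact Finset.single_le_sum (f := fun i => α i * s i)
        (fun i _ => mul_nonneg (hα i).le (h0 i)) (Finset.mem_univ i)
    have h3 : |(f + ∑ i, s i • r i) j| ≤ |f j| + ∑ i, 2 / α i * |r i j| := by
      simp only [Pi.add_apply, Finset.sum_apply, Pi.smul_apply, smul_eq_mul]
      refine (abs_add_le _ _).trans ?_
      gcongr
      refine (Finset.abs_sum_le_sum_abs _ _).trans ?_
      gcongr with i
      rw [abs_mul, abs_of_nonneg (h0 i)]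
      have := hsi i
      gcongr
    refine h3.trans ?_
    refine Finset.single_le_sum (f := fun j => |f j| + ∑ i, 2 / α i * |r i j|)
      (fun j _ => ?_) (Finset.mem_univ j)
    have : ∀ i, 0 ≤ 2 / α i * |r i j| := fun i => by have := hα i; positivity
    have := Finset.sum_nonneg fun i (_ : i ∈ Finset.univ) => this i
    positivity
  · rintro s ⟨h0, hb, -, -⟩ t ⟨h0', hb', -, -⟩ h
    obtain ⟨e1, e2⟩ := Prod.mk.inj h
    have := hb (s - t) ?_ ?_
    · exact sub_eq_zero.1 this
    · intro i hi
      have : i ∉ Finset.univ.filter fun i => t i ≠ 0 := by rw [← e2]; simp [hi]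
      simp at this
      simp [hi, this]
    · simp [sub_smul, add_left_cancel e1]

theorem exists_valid_add_smul {k : ℕ} {r : Fin k → Pt} {f : Pt} {α δ : Fin k → ℝ}
    (hα : ∀ i, 0 < α i) (hvalid : ValidIneq k r f α 1)
    (hδ : ∀ p ∈ mixedP k r f, ∑ i, α i * p.2 i = 1 → ∑ i, δ i * p.2 i = 0) :
    ∃ ε₀ : ℝ, 0 < ε₀ ∧ ∀ ε : ℝ, 0 < ε → ε ≤ ε₀ → ValidIneq k r f (α + ε • δ) 1 := by
  set B := {s : Fin k → ℝ | (∀ i, 0 ≤ s i) ∧ IsBasicFor r s ∧ IsIntPt (f + ∑ i, s i • r i) ∧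
      ∑ i, α i * s i ≤ 2}
  obtain ⟨η, hη0, hη1, hη⟩ : ∃ η : ℝ, 0 < η ∧ η ≤ 1 ∧
      ∀ s ∈ B, 1 < ∑ i, α i * s i → 1 + η ≤ ∑ i, α i * s i := by
    have hfin : {s ∈ B | 1 < ∑ i, α i * s i}.Finite :=
      (finite_basic_solutions r f hα).subset fun s h => h.1
    rcases {s ∈ B | 1 < ∑ i, α i * s i}.eq_empty_or_nonempty with h | h
    · refine ⟨1, one_pos, le_rfl, fun s hs h1 => ?_⟩
      have : s ∈ {s ∈ B | 1 < ∑ i, α i * s i} := ⟨hs, h1⟩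
      rw [h] at this
      exact this.elim
    · obtain ⟨s0, hs0, hmin⟩ := Set.exists_min_image _ (fun s => ∑ i, α i * s i) hfin h
      refine ⟨min 1 (∑ i, α i * s0 i - 1), lt_min one_pos (by linarith [hs0.2]),
        min_le_left _ _, fun s hs h1 => ?_⟩
      have := hmin s ⟨hs, h1⟩
      have h2 := min_le_right 1 (∑ i, α i * s0 i - 1)
      linarith
  set C : ℝ := 1 + ∑ i, |δ i| / α i with hC
  have hC0 : 0 ≤ ∑ i, |δ i| / α i :=
    Finset.sum_nonneg fun i _ => div_nonneg (abs_nonneg _) (hα i).le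
  have hδC : ∀ i, |δ i| ≤ C * α i := by
    intro i
    rw [← div_le_iff₀ (hα i)]
    have := Finset.single_le_sum (f := fun i => |δ i| / α i)
      (fun i _ => div_nonneg (abs_nonneg _) (hα i).le) (Finset.mem_univ i)
    linarith
  refine ⟨η / (1 + η) / C, by positivity, fun ε hε hle => ?_⟩
  rw [le_div_iff₀ (by positivity), le_div_iff₀ (by positivity)] at hle
  have hβ : ∀ i, (1 - ε * C) * α i ≤ (α + ε • δ) i := by
    intro i
    have h1 := (abs_le.1 (hδC i)).1
    simp only [Pi.add_apply, Pi.smul_apply, smul_eq_mul]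
    nlinarith
  have hθ : 0 < 1 - ε * C := by
    by_contra! h
    nlinarith
  intro p hp
  obtain ⟨s, h0, h1, h2, h3⟩ := exists_isBasicFor_le (r := r)
    (fun i => lt_of_lt_of_le (mul_pos hθ (hα i)) (hβ i)) p.2 hp.2.1
  refine le_trans ?_ h2
  have hmem : (f + ∑ i, s i • r i, s) ∈ mixedP k r f := by
    refine ⟨?_, h0, rfl⟩
    have := hp.1
    rw [hp.2.2, ← h1] at this
    exact this
  have hlow : (1 - ε * C) * ∑ i, α i * s i ≤ ∑ i, (α + ε • δ) i * s i := by
    rw [Finset.mul_sum]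
    refine Finset.sum_le_sum fun i _ => ?_
    rw [← mul_assoc]
    exact mul_le_mul_of_nonneg_right (hβ i) (h0 i)
  have hge := hvalid _ hmem
  simp only at hge
  rcases hge.eq_or_lt with heq | hlt
  · have := hδ _ hmem heq.symm
    simp only at this
    have e : ∑ i, (α + ε • δ) i * s i = ∑ i, α i * s i + ε * ∑ i, δ i * s i := by
      rw [Finset.mul_sum, ← Finset.sum_add_distrib]
      exact Finset.sum_congr rfl fun i _ => by simp; ring
    rw [e, this]
    linarith
  · have hgap : 1 + η ≤ ∑ i, α i * s i := by
      by_cases h : ∑ i, α i * s i ≤ 2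
      · exact hη s ⟨h0, h3, hmem.1, h⟩ hlt
      · linarith
    nlinarith

/-- A direction along which all tight solutions are stationary is trivial at a facet. -/
theorem IsFacet.eq_zero_of_tight {k : ℕ} {r : Fin k → Pt} {f : Pt} {α δ : Fin k → ℝ}
    (hr_rat : ∀ i, IsRatPt (r i)) (hne : (mixedP k r f).Nonempty)
    (hcone : coneGen (Set.range r) = Set.univ) (hfacet : IsFacet k r f α 1)
    (hα : ∀ i, 0 < α i)
    (hδ : ∀ p ∈ mixedP k r f, ∑ i, α i * p.2 i = 1 → ∑ i, δ i * p.2 i = 0) : δ = 0 := by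
  obtain ⟨ε₁, p₁, h₁⟩ := exists_valid_add_smul hα hfacet.1 hδ
  obtain ⟨ε₂, p₂, h₂⟩ := exists_valid_add_smul (δ := -δ) hα hfacet.1
    (fun p hp h => by simpa using hδ p hp h)
  have hm : 0 < min ε₁ ε₂ := lt_min p₁ p₂
  have := hfacet.eq_zero_of_valid_add_sub hr_rat hne hcone (δ := min ε₁ ε₂ • δ)
    (h₁ _ hm (min_le_left _ _))
    (by simpa [sub_eq_add_neg] using h₂ _ hm (min_le_right _ _))
  exact (smul_eq_zero.1 this).resolve_left hm.ne'

/-! ### Unbounded lattice-free sets -/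

theorem add_smul_mem_interior {L : Set Pt} {m : Pt}
    (hm : ∀ x ∈ L, ∀ t : ℝ, 0 ≤ t → x + t • m ∈ L) {x : Pt} (hx : x ∈ interior L) {t : ℝ}
    (ht : 0 ≤ t) : x + t • m ∈ interior L := by
  have h : (fun y => y + t • m) '' interior L ⊆ interior L := by
    refine interior_maximal ?_ ((Homeomorph.addRight (t • m)).isOpenMap _ isOpen_interior)
    rintro _ ⟨y, hy, rfl⟩
    exact hm y (interior_subset hy) t ht
  exact h ⟨x, hx, rfl⟩

theorem exists_splitSet_of_coprime {L : Set Pt} (hL : Convex ℝ L) {f : Pt}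
    (hf : f ∈ interior L) (hfree : LatticeFree L) {m0 m1 : ℤ} (hcop : IsCoprime m0 m1)
    (hm : ∀ x ∈ L, ∀ t : ℝ, 0 ≤ t → x + t • (![(m0 : ℝ), (m1 : ℝ)] : Pt) ∈ L) :
    ∃ T : Set Pt, IsSplitSet T ∧ L ⊆ T := by
  obtain ⟨p, q, hpq⟩ := hcop
  have hpq' : (p : ℝ) * m0 + q * m1 = 1 := by exact_mod_cast hpq
  have key : ∀ x ∈ interior L, ∀ c : ℤ, -(m1 : ℝ) * x 0 + m0 * x 1 ≠ c := by
    intro x hx c hc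
    set τ : ℝ := p * (x 0 + c * q) + q * (x 1 - c * p)
    obtain ⟨n, hn⟩ := exists_nat_ge τ
    refine hfree _ (add_smul_mem_interior hm hx (t := n - τ) (by linarith)) fun j => ?_
    fin_cases j
    · refine ⟨-c * q + n * m0, ?_⟩
      simp [τ]
      linear_combination (-x 0) * hpq' - q * hc
    · refine ⟨c * p + n * m1, ?_⟩
      simp [τ]
      linear_combination (-x 1) * hpq' + p * hc
  set π : Fin 2 → ℤ := ![-m1, m0]
  have hπ : ∀ x : Pt, ∑ j, (π j : ℝ) * x j = -(m1 : ℝ) * x 0 + m0 * x 1 := by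
    intro x; simp [π]
  set φ : Pt → ℝ := fun x => -(m1 : ℝ) * x 0 + m0 * x 1 with hφ
  have hlin : ∀ (x y : Pt) (a b : ℝ), φ (a • x + b • y) = a * φ x + b * φ y := by
    intro x y a b; simp [φ]; ring
  have hseg : ∀ x ∈ L, ∀ a b : ℝ, 0 < a → 0 < b → a + b = 1 → ∀ c : ℤ,
      a * φ f + b * φ x ≠ c := by
    intro x hx a b ha hb hab c
    rw [← hlin]
    exact key _ (hL.openSegment_interior_self_subset_interior hf hx ⟨a, b, ha, hb, hab, rfl⟩) c
  have hfl : (⌊φ f⌋ : ℝ) < φ f := lt_of_le_of_ne (Int.floor_le _) fun h => key f hf _ h.symm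
  have hfr : φ f < ⌊φ f⌋ + 1 := Int.lt_floor_add_one _
  refine ⟨_, ⟨π, ⌊φ f⌋, ?_, rfl⟩, fun x hx => ?_⟩
  · intro h
    have h0 := congrFun h 0
    have h1 := congrFun h 1
    simp [π] at h0 h1
    simp [h0, h1] at hpq
  · have gen : ∀ c : ℤ, φ x ≠ φ f → 0 < (c - φ f) / (φ x - φ f) →
        (c - φ f) / (φ x - φ f) < 1 → False := by
      intro c hne h1 h2
      refine hseg x hx (1 - (c - φ f) / (φ x - φ f)) ((c - φ f) / (φ x - φ f))
        (by linarith) h1 (by ring) c ?_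
      have : φ x - φ f ≠ 0 := sub_ne_zero.2 hne
      field_simp
      ring
    simp only [Set.mem_ofPred_eq, hπ]
    change _ ≤ φ x ∧ φ x ≤ _
    constructor
    · by_contra! h
      refine gen ⌊φ f⌋ (by linarith) (div_pos_of_neg_of_neg (by linarith) (by linarith)) ?_
      rw [div_lt_one_of_neg (by linarith)]; linarith
    · by_contra! h
      refine gen (⌊φ f⌋ + 1) (by linarith) (div_pos (by push_cast; linarith) (by linarith)) ?_
      rw [div_lt_one (by linarith)]; push_cast; linarith

theorem exists_splitSet_of_recession {L : Set Pt} (hL : Convex ℝ L) {f : Pt}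
    (hf : f ∈ interior L) (hfree : LatticeFree L) {u : Pt} (hu : u ≠ 0) (hrat : IsRatPt u)
    (hrec : ∀ x ∈ L, ∀ t : ℝ, 0 ≤ t → x + t • u ∈ L) :
    ∃ T : Set Pt, IsSplitSet T ∧ L ⊆ T := by
  obtain ⟨N, hN, hInt⟩ := hrat.exists_nat_smul_isIntPt
  obtain ⟨a, ha⟩ := hInt 0
  obtain ⟨b, hb⟩ := hInt 1
  simp only [Pi.smul_apply, smul_eq_mul] at ha hb
  have hN' : (0 : ℝ) < N := by exact_mod_cast hN
  have hab : a ≠ 0 ∨ b ≠ 0 := by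
    by_contra! h
    apply hu
    ext j
    fin_cases j
    · simpa [h.1, hN'.ne'] using ha
    · simpa [h.2, hN'.ne'] using hb
  have hg : 0 < Int.gcd a b := Int.gcd_pos_iff.2 hab
  obtain ⟨m0, m1, hcop, h0, h1⟩ := Int.exists_gcd_one hg
  refine exists_splitSet_of_coprime hL hf hfree (Int.isCoprime_iff_gcd_eq_one.2 hcop)
    fun x hx t ht => ?_
  have hg' : (0 : ℝ) < (Int.gcd a b : ℤ) := by exact_mod_cast hg
  have := hrec x hx (t * N / (Int.gcd a b : ℤ)) (by positivity)
  convert this using 2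
  rw [h0] at ha
  rw [h1] at hb
  push_cast at ha hb hg' ⊢
  ext j
  fin_cases j
  · simp
    field_simp
    linear_combination (-t) * ha
  · simp
    field_simp
    linear_combination (-t) * hb

/-! ### Supporting lines in the plane -/

/-- The linear functional on the plane with coefficients `g`. -/
def ev (g x : Pt) : ℝ := g 0 * x 0 + g 1 * x 1

/-- The quarter turn. -/
def perp (g : Pt) : Pt := ![-g 1, g 0]

theorem ev_add (g x y : Pt) : ev g (x + y) = ev g x + ev g y := by
  simp [ev]; ring

theorem ev_sub (g x y : Pt) : ev g (x - y) = ev g x - ev g y := by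
  simp [ev]; ring

theorem ev_smul (g : Pt) (t : ℝ) (x : Pt) : ev g (t • x) = t * ev g x := by
  simp [ev]; ring

theorem ev_neg_left (g x : Pt) : ev (-g) x = -ev g x := by
  simp [ev]; ring

theorem ev_sum {ι : Type*} (s : Finset ι) (g : Pt) (w : ι → ℝ) (x : ι → Pt) :
    ev g (∑ i ∈ s, w i • x i) = ∑ i ∈ s, w i * ev g (x i) := by
  classical
  induction s using Finset.induction_on with
  | empty => simp [ev]
  | insert a s ha ih => rw [Finset.sum_insert ha, Finset.sum_insert ha, ev_add, ev_smul, ih]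

theorem ev_comb (g x y : Pt) (a b : ℝ) : ev g (a • x + b • y) = a * ev g x + b * ev g y := by
  rw [ev_add, ev_smul, ev_smul]

theorem convex_ev_le (g : Pt) (c : ℝ) : Convex ℝ {x | ev g x ≤ c} := by
  intro x hx y hy a b ha hb hab
  simp only [Set.mem_ofPred_eq, ev_comb] at *
  calc a * ev g x + b * ev g y ≤ a * c + b * c := by gcongr
    _ = c := by rw [← add_mul, hab, one_mul]

theorem sq_add_sq_pos_of_ne_zero {g : Pt} (hg : g ≠ 0) : 0 < g 0 ^ 2 + g 1 ^ 2 := by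
  by_contra! h
  apply hg
  have h0 : g 0 = 0 := by nlinarith [sq_nonneg (g 0), sq_nonneg (g 1)]
  have h1 : g 1 = 0 := by nlinarith [sq_nonneg (g 0), sq_nonneg (g 1)]
  ext j; fin_cases j <;> simp [h0, h1]

theorem ext_of_ev {g : Pt} (hg : g ≠ 0) {x y : Pt} (h1 : ev g x = ev g y)
    (h2 : ev (perp g) x = ev (perp g) y) : x = y := by
  have hp := sq_add_sq_pos_of_ne_zero hg
  simp only [ev, perp, Matrix.cons_val_zero, Matrix.cons_val_one] at h1 h2
  have a : (g 0 ^ 2 + g 1 ^ 2) * x 0 = (g 0 ^ 2 + g 1 ^ 2) * y 0 := by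
    linear_combination g 0 * h1 - g 1 * h2
  have b : (g 0 ^ 2 + g 1 ^ 2) * x 1 = (g 0 ^ 2 + g 1 ^ 2) * y 1 := by
    linear_combination g 1 * h1 + g 0 * h2
  ext j; fin_cases j
  · exact mul_left_cancel₀ hp.ne' a
  · exact mul_left_cancel₀ hp.ne' b

theorem exists_support {L : Set Pt} (hL : Convex ℝ L) (hi : (interior L).Nonempty) {x : Pt}
    (hx : x ∉ interior L) : ∃ g : Pt, g ≠ 0 ∧ ∀ y ∈ L, ev g y ≤ ev g x := by
  obtain ⟨φ, hφ⟩ := geometric_hahn_banach_open_point hL.interior isOpen_interior hx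
  have hrep : ∀ y : Pt, φ y = ev ![φ (Pi.single 0 1), φ (Pi.single 1 1)] y := by
    intro y
    have : y = y 0 • Pi.single 0 1 + y 1 • Pi.single 1 1 := by
      ext j; fin_cases j <;> simp
    conv_lhs => rw [this]
    simp [ev]; ring
  refine ⟨![φ (Pi.single 0 1), φ (Pi.single 1 1)], fun h0 => ?_, fun y hy => ?_⟩
  · obtain ⟨y, hy⟩ := hi
    have := hφ y hy
    rw [hrep, hrep x, h0] at this
    simp [ev] at this
  · rw [← hrep, ← hrep]
    have hc : L ⊆ {y | φ y ≤ φ x} := by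
      refine subset_closure.trans ?_
      rw [← hL.closure_interior_eq_closure_of_nonempty_interior hi]
      exact closure_minimal (fun y hy => (hφ y hy).le)
        (isClosed_le φ.continuous continuous_const)
    exact hc hy

theorem ev_lt_of_mem_interior {L : Set Pt} {g : Pt} (hg : g ≠ 0) {c : ℝ}
    (h : ∀ y ∈ L, ev g y ≤ c) {x : Pt} (hx : x ∈ interior L) : ev g x < c := by
  have hp := sq_add_sq_pos_of_ne_zero hg
  have hc : Filter.Tendsto (fun ε : ℝ => x + ε • g) (nhdsWithin 0 (Set.Ioi 0)) (nhds x) := by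
    have : Continuous fun ε : ℝ => x + ε • g := by fun_prop
    have h2 := (this.tendsto 0).mono_left (nhdsWithin_le_nhds (s := Set.Ioi 0))
    simpa using h2
  have h1 := hc.eventually (mem_interior_iff_mem_nhds.1 hx)
  obtain ⟨ε, hε, hpos⟩ := (h1.and self_mem_nhdsWithin).exists
  have hpos : (0 : ℝ) < ε := hpos
  have := h _ hε
  rw [ev_add, ev_smul] at this
  have e : ev g g = g 0 ^ 2 + g 1 ^ 2 := by simp [ev]; ring
  rw [e] at this
  nlinarith [mul_pos hpos hp]

theorem not_mem_interior_of_support {L : Set Pt} {g : Pt} (hg : g ≠ 0) {x : Pt}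
    (h : ∀ y ∈ L, ev g y ≤ ev g x) : x ∉ interior L := fun hx =>
  lt_irrefl _ (ev_lt_of_mem_interior hg h hx)

theorem mem_openSegment_of_ev_lt {g a b c : Pt} (hg : g ≠ 0) (hab : ev g a = ev g b)
    (hbc : ev g b = ev g c) (h1 : ev (perp g) a < ev (perp g) b)
    (h2 : ev (perp g) b < ev (perp g) c) : b ∈ openSegment ℝ a c := by
  set A := ev (perp g) a
  set B := ev (perp g) b
  set C := ev (perp g) c
  refine ⟨(C - B) / (C - A), (B - A) / (C - A), div_pos (by linarith) (by linarith),
    div_pos (by linarith) (by linarith), ?_, ?_⟩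
  · have : C - A ≠ 0 := by linarith
    field_simp; ring
  · have h3 : C - A ≠ 0 := by linarith
    refine ext_of_ev hg ?_ ?_
    · rw [ev_comb, hab, ← hbc, ← add_mul]
      have : (C - B) / (C - A) + (B - A) / (C - A) = 1 := by field_simp; ring
      rw [this, one_mul]
    · rw [ev_comb]
      change _ * A + _ * C = B
      field_simp; ring

/-- Three extreme points are never collinear. -/
theorem extremePoints_not_collinear {L : Set Pt} {g : Pt} (hg : g ≠ 0) {a b c : Pt}
    (ha : a ∈ L.extremePoints ℝ) (hb : b ∈ L.extremePoints ℝ) (hc : c ∈ L.extremePoints ℝ)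
    (hab : a ≠ b) (hbc : b ≠ c) (hac : a ≠ c) (h1 : ev g a = ev g b) (h2 : ev g b = ev g c) :
    False := by
  have inj : ∀ {x y : Pt}, x ≠ y → ev g x = ev g y → ev (perp g) x ≠ ev (perp g) y :=
    fun hne h h' => hne (ext_of_ev hg h h')
  have key : ∀ {x y z : Pt}, x ∈ L.extremePoints ℝ → y ∈ L.extremePoints ℝ →
      z ∈ L.extremePoints ℝ → ev g x = ev g y → ev g y = ev g z → x ≠ y →
      ev (perp g) x < ev (perp g) y → ev (perp g) y < ev (perp g) z → False := by
    intro x y z hx hy hz e1 e2 hne l1 l2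
    exact hne (((mem_extremePoints.1 hy).2 x hx.1 z hz.1
      (mem_openSegment_of_ev_lt hg e1 e2 l1 l2)).1)
  have h3 := h1.trans h2
  rcases lt_or_gt_of_ne (inj hab h1) with l1 | l1 <;>
  rcases lt_or_gt_of_ne (inj hbc h2) with l2 | l2 <;>
  rcases lt_or_gt_of_ne (inj hac h3) with l3 | l3
  · exact key ha hb hc h1 h2 hab l1 l2
  · linarith
  · exact key ha hc hb h3 h2.symm hac l3 l2
  · exact key hc ha hb h3.symm h1 hac.symm l3 l1
  · exact key hb ha hc h1.symm h3 hab.symm l1 l3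
  · exact key hb hc ha h2 h3.symm hbc l2 l3
  · linarith
  · exact key hc hb ha h2.symm h1.symm hbc.symm l2 l1

theorem eq_zero_of_collinear_support {L : Set Pt} {W : Finset Pt}
    (hW : ∀ w ∈ W, w ∈ L.extremePoints ℝ) {g : Pt} (hg : g ≠ 0) {c : ℝ} {ν : Pt → ℝ}
    (hν : ∀ w ∈ W, ν w ≠ 0 → ev g w = c) (h0 : ∑ w ∈ W, ν w = 0)
    (h1 : ∑ w ∈ W, ν w • w = 0) : ∀ w ∈ W, ν w = 0 := by
  classical
  by_contra! hcon
  obtain ⟨w, hw, hw0⟩ := hcon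
  obtain ⟨w', hw', hne, hw0'⟩ : ∃ w' ∈ W, w' ≠ w ∧ ν w' ≠ 0 := by
    by_contra! h
    rw [Finset.sum_eq_single_of_mem w hw h] at h0
    exact hw0 h0
  have hrest : ∀ v ∈ W, v ≠ w ∧ v ≠ w' → ν v = 0 := by
    intro v hv ⟨h2, h3⟩
    by_contra hv0
    have e := hν w hw hw0
    have e' := hν w' hw' hw0'
    have e'' := hν v hv hv0
    exact extremePoints_not_collinear hg (hW w hw) (hW w' hw') (hW v hv) hne.symm h3.symm h2.symm
      (by rw [e, e']) (by rw [e', e''])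
  rw [Finset.sum_eq_add_of_mem w w' hw hw' hne.symm hrest] at h0
  rw [Finset.sum_eq_add_of_mem w w' hw hw' hne.symm
    (fun v hv h => by rw [hrest v hv h, zero_smul])] at h1
  have : ν w' = -ν w := by linarith
  rw [this, neg_smul, ← sub_eq_add_neg, ← smul_sub, smul_eq_zero] at h1
  rcases h1 with h | h
  · exact hw0 h
  · exact hne (sub_eq_zero.1 h).symm

/-- A convex representation of a point on a supporting line only uses points of that line. -/
theorem ev_eq_of_weight_ne_zero {W : Finset Pt} {g : Pt} {c : ℝ} {l : Pt → ℝ}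
    (hle : ∀ w ∈ W, ev g w ≤ c) (hl : ∀ w ∈ W, 0 ≤ l w) (h1 : ∑ w ∈ W, l w = 1)
    (hx : c ≤ ev g (∑ w ∈ W, l w • w)) : ∀ w ∈ W, l w ≠ 0 → ev g w = c := by
  intro w hw hne
  rw [ev_sum] at hx
  have hsum : ∑ w ∈ W, l w * (c - ev g w) = c - ∑ w ∈ W, l w * ev g w := by
    simp_rw [mul_sub]
    rw [Finset.sum_sub_distrib, ← Finset.sum_mul, h1, one_mul]
  have hnn : ∀ w ∈ W, 0 ≤ l w * (c - ev g w) := fun v hv =>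
    mul_nonneg (hl v hv) (by linarith [hle v hv])
  have hz : ∑ w ∈ W, l w * (c - ev g w) = 0 :=
    le_antisymm (by rw [hsum]; linarith) (Finset.sum_nonneg hnn)
  have := (Finset.sum_eq_zero_iff_of_nonneg hnn).1 hz w hw
  rcases mul_eq_zero.1 this with h | h
  · exact absurd h hne
  · linarith

/-! ### Bounded induced sets -/

/-- A lattice-free polygon with vertex set `W` that has at most as many vertices as any set of
boundary points accounting for all its lattice points. -/
structure IsFacetPolygon (L : Set Pt) (W : Finset Pt) : Prop where
  eq_hull : L = convexHull ℝ (W : Set Pt)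
  extreme : ∀ w ∈ W, w ∈ L.extremePoints ℝ
  nonempty_interior : (interior L).Nonempty
  free : LatticeFree L
  card_le : ∀ X : Finset Pt, (∀ x ∈ X, x ∈ L) → (∀ x ∈ X, x ∉ interior L) →
    (∀ z ∈ L, IsIntPt z → z ∈ X ∨ ∃ g : Pt, g ≠ 0 ∧ ∃ p ∈ X, ∃ q ∈ X, p ≠ q ∧
      (∀ y ∈ L, ev g y ≤ ev g p) ∧ ev g q = ev g p ∧ ev g z = ev g p) → W.card ≤ X.card

theorem exists_combination_of_ev_eq {g p q z : Pt} (hg : g ≠ 0) (hpq : p ≠ q)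
    (h1 : ev g q = ev g p) (h2 : ev g z = ev g p) : ∃ t : ℝ, z = (1 - t) • p + t • q := by
  have hne : ev (perp g) q - ev (perp g) p ≠ 0 := fun h =>
    hpq (ext_of_ev hg h1.symm (by linarith))
  refine ⟨(ev (perp g) z - ev (perp g) p) / (ev (perp g) q - ev (perp g) p),
    ext_of_ev hg ?_ ?_⟩
  · rw [ev_comb, h1, h2]; ring
  · rw [ev_comb]; field_simp; ring

theorem IsFacet.card_le {k : ℕ} {r : Fin k → Pt} {f : Pt} {α : Fin k → ℝ}
    (hr_rat : ∀ i, IsRatPt (r i)) (hne : (mixedP k r f).Nonempty)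
    (hcone : coneGen (Set.range r) = Set.univ) (hfacet : IsFacet k r f α 1)
    (hα : ∀ i, 0 < α i) {L : Set Pt} (hLdef : L = inducedSet k r f α) {W : Finset Pt}
    (hLW : L = convexHull ℝ (W : Set Pt)) (hext : ∀ w ∈ W, w ∈ L.extremePoints ℝ)
    (hWr : ∀ w ∈ W, ∃ i, w = f + (α i)⁻¹ • r i) (X : Finset Pt) (hXL : ∀ x ∈ X, x ∈ L)
    (hXi : ∀ x ∈ X, x ∉ interior L)
    (hX : ∀ z ∈ L, IsIntPt z → z ∈ X ∨ ∃ g : Pt, g ≠ 0 ∧ ∃ p ∈ X, ∃ q ∈ X, p ≠ q ∧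
      (∀ y ∈ L, ev g y ≤ ev g p) ∧ ev g q = ev g p ∧ ev g z = ev g p) :
    W.card ≤ X.card := by
  classical
  by_contra! hlt
  have hα' : ∀ i, 0 ≤ α i := fun i => (hα i).le
  have hLconv : Convex ℝ L := by rw [hLdef]; exact convex_inducedSet _ _ _ _
  have hLint : (interior L).Nonempty := ⟨f, by rw [hLdef]; exact mem_interior_inducedSet hα' hcone⟩
  have hWL : ∀ w ∈ W, w ∈ L := fun w hw => (hext w hw).1
  have hrep : ∀ y, ∃ l : Pt → ℝ, y ∈ L → (∀ w ∈ W, 0 ≤ l w) ∧ ∑ w ∈ W, l w = 1 ∧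
      ∑ w ∈ W, l w • w = y := by
    intro y
    by_cases hy : y ∈ L
    · rw [hLW, Finset.mem_convexHull'] at hy
      obtain ⟨l, hl⟩ := hy
      exact ⟨l, fun _ => hl⟩
    · exact ⟨0, fun h => absurd h hy⟩
  choose rep hrep using hrep
  let T : (W → ℝ) →ₗ[ℝ] (X → ℝ) :=
    LinearMap.pi fun x => Fintype.linearCombination ℝ fun w : W => rep x w
  have hker : LinearMap.ker T ≠ ⊥ := LinearMap.ker_ne_bot_of_finrank_lt (by simpa using hlt)
  obtain ⟨d, hd, hd0⟩ := Submodule.exists_mem_ne_zero_of_ne_bot hker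
  let D : Pt → ℝ := fun p => if h : p ∈ W then d ⟨p, h⟩ else 0
  have hDX : ∀ x ∈ X, ∑ w ∈ W, rep x w * D w = 0 := by
    intro x hx
    have h := congrFun (LinearMap.mem_ker.1 hd) ⟨x, hx⟩
    simp only [T, LinearMap.pi_apply, Fintype.linearCombination_apply, Pi.zero_apply,
      smul_eq_mul] at h
    rw [← Finset.sum_attach, ← h, Finset.univ_eq_attach]
    refine Finset.sum_congr rfl fun w _ => ?_
    simp [D, mul_comm]
  obtain ⟨w0, hw0, hDw0⟩ : ∃ w ∈ W, D w ≠ 0 := by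
    obtain ⟨w, hw⟩ := Function.ne_iff.1 hd0
    exact ⟨w, w.2, by simpa [D] using hw⟩
  let w : Fin k → Pt := fun i => f + (α i)⁻¹ • r i
  have hwL : ∀ i, w i ∈ L := by
    intro i
    rw [hLdef, mem_inducedSet_iff hα']
    refine ⟨Pi.single i (α i)⁻¹, fun j => ?_, ?_, ?_⟩
    · by_cases h : j = i
      · subst h; simp [hα' j]
      · simp [h]
    · rw [Finset.sum_eq_single i] <;> simp +contextual [(hα i).ne']
    · rw [Finset.sum_eq_single i] <;> simp +contextual [w]
  let μ : Fin k → Pt → ℝ := fun i => if w i ∈ W then Pi.single (w i) 1 else rep (w i)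
  have hμ : ∀ i, (∀ v ∈ W, 0 ≤ μ i v) ∧ ∑ v ∈ W, μ i v = 1 ∧ ∑ v ∈ W, μ i v • v = w i := by
    intro i
    by_cases h : w i ∈ W
    · simp only [μ, if_pos h]
      refine ⟨fun v _ => ?_, ?_, ?_⟩
      · by_cases hv : v = w i
        · subst hv; simp
        · simp [hv]
      · rw [Finset.sum_eq_single_of_mem _ h] <;> simp +contextual
      · rw [Finset.sum_eq_single_of_mem _ h] <;> simp +contextual
    · simp only [μ, if_neg h]
      exact hrep _ (hwL i)
  have hδ : (fun i => α i * ∑ v ∈ W, μ i v * D v) = 0 := by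
    refine hfacet.eq_zero_of_tight hr_rat hne hcone hα fun p hp htight => ?_
    obtain ⟨x, s⟩ := p
    obtain ⟨hxint, hs, hx⟩ := hp
    simp only at hxint hs hx htight ⊢
    have hxL : x ∈ L := by
      rw [hLdef, mem_inducedSet_iff hα']; exact ⟨s, hs, htight.le, hx⟩
    set κ : Pt → ℝ := fun v => ∑ i, α i * s i * μ i v with hκ
    have κ0 : ∀ v ∈ W, 0 ≤ κ v := fun v hv => Finset.sum_nonneg fun i _ =>
      mul_nonneg (mul_nonneg (hα' i) (hs i)) ((hμ i).1 v hv)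
    have κ1 : ∑ v ∈ W, κ v = 1 := by
      rw [Finset.sum_comm, ← htight]
      refine Finset.sum_congr rfl fun i _ => ?_
      rw [← Finset.mul_sum, (hμ i).2.1, mul_one]
    have κx : ∑ v ∈ W, κ v • v = x := by
      simp only [hκ, Finset.sum_smul]
      rw [Finset.sum_comm]
      have : ∀ i, ∑ v ∈ W, (α i * s i * μ i v) • v = (α i * s i) • f + s i • r i := by
        intro i
        simp_rw [mul_smul (α i * s i)]
        rw [← Finset.smul_sum, (hμ i).2.2]
        simp only [w, smul_add, smul_smul]
        congr 2
        have := (hα i).ne'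
        field_simp
      simp_rw [this]
      rw [Finset.sum_add_distrib, ← Finset.sum_smul, htight, one_smul, hx]
    have hgoal : ∑ i, α i * (∑ v ∈ W, μ i v * D v) * s i = ∑ v ∈ W, κ v * D v := by
      simp only [hκ, Finset.sum_mul, Finset.mul_sum]
      rw [Finset.sum_comm]
      refine Finset.sum_congr rfl fun v _ => Finset.sum_congr rfl fun i _ => by ring
    rw [hgoal]
    rcases hX x hxL hxint with hxX | ⟨g, hg, p, hp, q, hq, hpq, hsup, hqp, hxp⟩
    · obtain ⟨g, hg, hsup⟩ := exists_support hLconv hLint (hXi x hxX)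
      obtain ⟨l0, l1, lx⟩ := hrep x hxL
      have hz := eq_zero_of_collinear_support hext hg (c := ev g x) (ν := fun v => κ v - rep x v)
        (fun v hv hv0 => ?_) (by rw [Finset.sum_sub_distrib, κ1, l1, sub_self])
        (by simp only [sub_smul]; rw [Finset.sum_sub_distrib, κx, lx, sub_self])
      · rw [← hDX x hxX]
        refine Finset.sum_congr rfl fun v hv => ?_
        rw [sub_eq_zero.1 (hz v hv)]
      · by_cases hκ0 : κ v = 0
        · refine ev_eq_of_weight_ne_zero (fun w hw => hsup w (hWL w hw)) l0 l1 (by rw [lx]) v hv ?_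
          intro h; simp [hκ0, h] at hv0
        · exact ev_eq_of_weight_ne_zero (fun w hw => hsup w (hWL w hw)) κ0 κ1 (by rw [κx]) v hv hκ0
    · obtain ⟨t, ht⟩ := exists_combination_of_ev_eq hg hpq hqp hxp
      obtain ⟨a0, a1, ax⟩ := hrep p (hXL p hp)
      obtain ⟨b0, b1, bx⟩ := hrep q (hXL q hq)
      have hz := eq_zero_of_collinear_support hext hg (c := ev g p)
        (ν := fun v => κ v - ((1 - t) * rep p v + t * rep q v)) (fun v hv hv0 => ?_)
        (by rw [Finset.sum_sub_distrib, Finset.sum_add_distrib, ← Finset.mul_sum,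
              ← Finset.mul_sum, κ1, a1, b1]; ring)
        (by simp only [fun v : Pt => sub_smul (κ v) ((1 - t) * rep p v + t * rep q v) v,
              add_smul, mul_smul]
            rw [Finset.sum_sub_distrib, Finset.sum_add_distrib, ← Finset.smul_sum,
              ← Finset.smul_sum, κx, ax, bx, ht, sub_self])
      · have e : ∑ v ∈ W, κ v * D v
            = (1 - t) * ∑ v ∈ W, rep p v * D v + t * ∑ v ∈ W, rep q v * D v := by
          rw [Finset.mul_sum, Finset.mul_sum, ← Finset.sum_add_distrib]
          refine Finset.sum_congr rfl fun v hv => ?_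
          rw [sub_eq_zero.1 (hz v hv)]; ring
        rw [e, hDX p hp, hDX q hq]; ring
      · have hle : ∀ w ∈ W, ev g w ≤ ev g p := fun w hw => hsup w (hWL w hw)
        by_cases hκ0 : κ v = 0
        · by_cases ha0 : rep p v = 0
          · refine ev_eq_of_weight_ne_zero hle b0 b1 (by rw [bx, hqp]) v hv fun h => ?_
            simp [hκ0, ha0, h] at hv0
          · exact ev_eq_of_weight_ne_zero hle a0 a1 (by rw [ax]) v hv ha0
        · exact ev_eq_of_weight_ne_zero hle κ0 κ1 (by rw [κx, hxp]) v hv hκ0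
  obtain ⟨i, hi⟩ := hWr w0 hw0
  have hi' : w i = w0 := hi.symm
  have := congrFun hδ i
  simp only [μ, hi', if_pos hw0, Pi.zero_apply, mul_eq_zero, (hα i).ne', false_or] at this
  rw [Finset.sum_eq_single_of_mem w0 hw0 (by simp +contextual)] at this
  simp at this
  exact hDw0 this

theorem IsFacet.exists_isFacetPolygon {k : ℕ} {r : Fin k → Pt} {f : Pt} {α : Fin k → ℝ}
    (hr_rat : ∀ i, IsRatPt (r i)) (hne : (mixedP k r f).Nonempty)
    (hcone : coneGen (Set.range r) = Set.univ) (hfacet : IsFacet k r f α 1)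
    (hα : ∀ i, 0 < α i) : ∃ W : Finset Pt, IsFacetPolygon (inducedSet k r f α) W := by
  classical
  have hα' : ∀ i, 0 ≤ α i := fun i => (hα i).le
  set L := inducedSet k r f α with hLdef
  have hfi : f ∈ interior L := mem_interior_inducedSet hα' hcone
  set G : Set Pt := {f} ∪ {x | ∃ i, 0 < α i ∧ x = f + (α i)⁻¹ • r i} with hG
  have hGfin : G.Finite := by
    refine (Set.finite_singleton f).union
      ((Set.finite_range fun i => f + (α i)⁻¹ • r i).subset ?_)
    rintro x ⟨i, -, rfl⟩
    exact ⟨i, rfl⟩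
  have hLG : L = convexHull ℝ G := by
    have : coneGen {x | ∃ i, α i = 0 ∧ x = r i} = {0} := by
      ext z
      rw [mem_coneGen_index_iff (p := fun i => α i = 0)]
      constructor
      · rintro ⟨s, -, h, rfl⟩
        simp [fun i => h i (hα i).ne']
      · rintro rfl
        exact ⟨0, by simp⟩
    rw [hLdef, inducedSet, this]
    simp [hG]
  have hsub : L.extremePoints ℝ ⊆ G := by rw [hLG]; exact extremePoints_convexHull_subset
  have hEfin : (L.extremePoints ℝ).Finite := hGfin.subset hsub
  have hcomp : IsCompact L := by rw [hLG]; exact hGfin.isCompact_convexHull ℝ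
  have hLconv : Convex ℝ L := convex_inducedSet _ _ _ _
  have hLW : L = convexHull ℝ (L.extremePoints ℝ) := by
    conv_lhs => rw [← closure_convexHull_extremePoints hcomp hLconv]
    exact (hEfin.isClosed_convexHull ℝ).closure_eq
  have hfext : f ∉ L.extremePoints ℝ := by
    intro h
    obtain ⟨t, ht, h1⟩ := exists_pos_add_smul_mem_inducedSet (f := f) hα' hcone ![1, 0]
    obtain ⟨t', ht', h2⟩ := exists_pos_add_smul_mem_inducedSet (f := f) hα' hcone (-![1, 0])
    have m1 := h1 (min t t') (by positivity) (min_le_left _ _)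
    have m2 := h2 (min t t') (by positivity) (min_le_right _ _)
    have := ((mem_extremePoints.1 h).2 _ m1 _ m2
      ⟨1 / 2, 1 / 2, by norm_num, by norm_num, by norm_num, by module⟩).1
    have := congrFun this 0
    have hp : 0 < min t t' := by positivity
    simp only [Pi.add_apply, Pi.smul_apply, Matrix.cons_val_zero, smul_eq_mul, mul_one] at this
    linarith
  refine ⟨hEfin.toFinset, ⟨by simpa using hLW, by simp, ⟨f, hfi⟩,
    fun x hx => not_isIntPt_of_mem_interior_inducedSet hα' hfacet.1 hx, fun X => ?_⟩⟩
  refine hfacet.card_le hr_rat hne hcone hα hLdef (by simpa using hLW) (by simp) ?_ X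
  intro w hw
  rw [Set.Finite.mem_toFinset] at hw
  rcases hsub hw with h | ⟨i, -, h⟩
  · rw [Set.mem_singleton_iff] at h
    subst h; exact absurd hw hfext
  · exact ⟨i, h⟩

/-! ### Cyclic labelings of the vertices -/

namespace IsFacetPolygon

variable {L : Set Pt} {W : Finset Pt}

theorem convex (hP : IsFacetPolygon L W) : Convex ℝ L := by
  rw [hP.eq_hull]; exact convex_convexHull _ _

theorem mem (hP : IsFacetPolygon L W) {w : Pt} (hw : w ∈ W) : w ∈ L := (hP.extreme w hw).1

theorem ev_le (hP : IsFacetPolygon L W) {g : Pt} {c : ℝ} (h : ∀ w ∈ W, ev g w ≤ c) {y : Pt}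
    (hy : y ∈ L) : ev g y ≤ c := by
  rw [hP.eq_hull] at hy
  exact convexHull_min h (convex_ev_le g c) hy

theorem exists_ev_ne (hP : IsFacetPolygon L W) {g : Pt} (hg : g ≠ 0) (c : ℝ) :
    ∃ w ∈ W, ev g w ≠ c := by
  by_contra! h
  obtain ⟨f, hf⟩ := hP.nonempty_interior
  have h1 := ev_lt_of_mem_interior hg (fun y hy => hP.ev_le (fun w hw => (h w hw).le) hy) hf
  have h2 := hP.ev_le (g := -g) (c := -c) (fun w hw => by rw [ev_neg_left, h w hw])
    (interior_subset hf)
  rw [ev_neg_left] at h2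
  linarith

theorem three_le_card (hP : IsFacetPolygon L W) : 3 ≤ W.card := by
  by_contra! h
  have hab : ∃ a b : Pt, ∀ w ∈ W, w = a ∨ w = b := by
    rcases Nat.lt_or_ge W.card 2 with h1 | h1
    · rcases Nat.lt_or_ge W.card 1 with h0 | h0
      · have : W = ∅ := Finset.card_eq_zero.1 (by omega)
        exact ⟨0, 0, by simp [this]⟩
      · obtain ⟨a, ha⟩ := Finset.card_eq_one.1 (show W.card = 1 by omega)
        exact ⟨a, a, by simp [ha]⟩
    · obtain ⟨a, b, -, hab⟩ := Finset.card_eq_two.1 (show W.card = 2 by omega)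
      exact ⟨a, b, by simp [hab]⟩
  obtain ⟨a, b, hab⟩ := hab
  obtain ⟨g, hg, he⟩ : ∃ g : Pt, g ≠ 0 ∧ ev g b = ev g a := by
    by_cases h : a = b
    · exact ⟨![1, 0], fun h => by simpa using congrFun h 0, by rw [h]⟩
    · refine ⟨perp (b - a), fun h' => h ?_, ?_⟩
      · have h0 := congrFun h' 0
        have h1 := congrFun h' 1
        simp [perp] at h0 h1
        ext j; fin_cases j
        · simp; linarith
        · simp; linarith
      · simp [ev, perp]; ring
  obtain ⟨w, hw, hne⟩ := hP.exists_ev_ne hg (ev g a)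
  rcases hab w hw with rfl | rfl
  · exact hne rfl
  · exact hne he

theorem exists_edge (hP : IsFacetPolygon L W) {x : Pt} (hx : x ∈ L) (hxi : x ∉ interior L) :
    ∃ g : Pt, g ≠ 0 ∧ ∃ a ∈ W, ∃ b ∈ W, x ∈ segment ℝ a b ∧ ev g b = ev g a ∧
      ∀ y ∈ L, ev g y ≤ ev g a := by
  classical
  obtain ⟨g, hg, hs⟩ := exists_support hP.convex hP.nonempty_interior hxi
  have hx' := hx
  rw [hP.eq_hull, Finset.mem_convexHull'] at hx'
  obtain ⟨l, l0, l1, lx⟩ := hx'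
  have hl := ev_eq_of_weight_ne_zero (fun w hw => hs w (hP.mem hw)) l0 l1 (by rw [lx])
  obtain ⟨a, ha, hla⟩ : ∃ a ∈ W, l a ≠ 0 := by
    by_contra! h
    rw [Finset.sum_eq_zero h] at l1
    norm_num at l1
  refine ⟨g, hg, a, ha, ?_⟩
  by_cases hb : ∃ b ∈ W, b ≠ a ∧ l b ≠ 0
  · obtain ⟨b, hb, hba, hlb⟩ := hb
    have hrest : ∀ v ∈ W, v ≠ a ∧ v ≠ b → l v = 0 := by
      rintro v hv ⟨h1, h2⟩
      by_contra h0
      exact extremePoints_not_collinear hg (hP.extreme a ha) (hP.extreme b hb) (hP.extreme v hv)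
        hba.symm h2.symm h1.symm (by rw [hl a ha hla, hl b hb hlb]) (by rw [hl b hb hlb, hl v hv h0])
    rw [Finset.sum_eq_add_of_mem a b ha hb hba.symm hrest] at l1
    rw [Finset.sum_eq_add_of_mem a b ha hb hba.symm
      (fun v hv h => by rw [hrest v hv h, zero_smul])] at lx
    exact ⟨b, hb, ⟨l a, l b, l0 a ha, l0 b hb, l1, lx⟩, by rw [hl a ha hla, hl b hb hlb],
      by rw [hl a ha hla]; exact hs⟩
  · push Not at hb
    rw [Finset.sum_eq_single_of_mem a ha hb] at l1
    rw [Finset.sum_eq_single_of_mem a ha (fun v hv h => by rw [hb v hv h, zero_smul]), l1,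
      one_smul] at lx
    subst lx
    exact ⟨a, ha, left_mem_segment _ _ _, rfl, hs⟩

end IsFacetPolygon

/-- A labeling of the vertex set `W` of the polygon `L` in cyclic order. -/
structure IsCyclicLabeling {n : ℕ} [NeZero n] (L : Set Pt) (W : Finset Pt) (v : Fin n → Pt) :
    Prop where
  injective : Function.Injective v
  mem_iff : ∀ w, w ∈ W ↔ ∃ i, v i = w
  exists_side : ∀ i, ∃ g : Pt, g ≠ 0 ∧ (∀ y ∈ L, ev g y ≤ ev g (v i)) ∧
    ev g (v (i + 1)) = ev g (v i) ∧ ∀ j, ev g (v j) = ev g (v i) → j = i ∨ j = i + 1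
  boundary : ∀ x ∈ L, x ∉ interior L → ∃ i, x ∈ segment ℝ (v i) (v (i + 1))

namespace IsCyclicLabeling

variable {L : Set Pt} {W : Finset Pt} {n : ℕ} [NeZero n] {v : Fin n → Pt}

theorem mem (hv : IsCyclicLabeling L W v) (i : Fin n) : v i ∈ W := (hv.mem_iff _).2 ⟨i, rfl⟩

theorem coe_eq_range (hv : IsCyclicLabeling L W v) : (W : Set Pt) = Set.range v := by
  ext w; simp [hv.mem_iff]

theorem segment_subset (hv : IsCyclicLabeling L W v) (hP : IsFacetPolygon L W) (i j : Fin n) :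
    segment ℝ (v i) (v j) ⊆ L :=
  hP.convex.segment_subset (hP.mem (hv.mem i)) (hP.mem (hv.mem j))

theorem ev_eq_of_mem_segment {g a b z : Pt} (hab : ev g b = ev g a) (hz : z ∈ segment ℝ a b) :
    ev g z = ev g a := by
  obtain ⟨s, t, -, -, hst, rfl⟩ := hz
  rw [ev_comb, hab, ← add_mul, hst, one_mul]

theorem not_mem_interior (hv : IsCyclicLabeling L W v) {i : Fin n} {z : Pt}
    (hz : z ∈ segment ℝ (v i) (v (i + 1))) : z ∉ interior L := by
  obtain ⟨g, hg, hle, he, -⟩ := hv.exists_side i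
  exact not_mem_interior_of_support hg (by rwa [ev_eq_of_mem_segment he hz])

theorem eq_of_comb_eq_of_le {s t a b c : ℝ} (hs : 0 < s) (ht : 0 < t) (hst : s + t = 1)
    (ha : a ≤ c) (hb : b ≤ c) (h : s * a + t * b = c) : a = c ∧ b = c := by
  have e : s * (c - a) + t * (c - b) = 0 := by linear_combination c * hst - h
  have h1 : 0 ≤ s * (c - a) := mul_nonneg hs.le (by linarith)
  have h2 : 0 ≤ t * (c - b) := mul_nonneg ht.le (by linarith)
  have h3 : s * (c - a) = 0 := by linarith
  have h4 : t * (c - b) = 0 := by linarith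
  rcases mul_eq_zero.1 h3 with h | h <;> rcases mul_eq_zero.1 h4 with h' | h' <;>
    constructor <;> linarith

/-- Distinct sides meet in vertices only. -/
theorem eq_of_mem_openSegment (hv : IsCyclicLabeling L W v) (hP : IsFacetPolygon L W)
    (hn : (1 + 1 : Fin n) ≠ 0) {i j : Fin n} {z : Pt} (hj : z ∈ openSegment ℝ (v j) (v (j + 1)))
    (hi : z ∈ segment ℝ (v i) (v (i + 1))) : i = j := by
  obtain ⟨g, hg, hle, he, heq⟩ := hv.exists_side i
  have hz := ev_eq_of_mem_segment he hi
  obtain ⟨s, t, hs, ht, hst, rfl⟩ := hj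
  rw [ev_comb] at hz
  have h1 := hle _ (hP.mem (hv.mem j))
  have h2 := hle _ (hP.mem (hv.mem (j + 1)))
  obtain ⟨e1, e2⟩ := eq_of_comb_eq_of_le hs ht hst h1 h2 hz
  rcases heq _ e1 with h | h
  · exact h.symm
  · rcases heq _ e2 with h' | h'
    · exfalso
      rw [h, add_assoc] at h'
      exact hn (by simpa using h')
    · exact (add_right_cancel h').symm

end IsCyclicLabeling

theorem ne_zero_and_perp_of_ne {a b : Pt} (h : a ≠ b) :
    perp (b - a) ≠ 0 ∧ ev (perp (b - a)) b = ev (perp (b - a)) a := by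
  refine ⟨fun h' => h ?_, by simp [ev, perp]; ring⟩
  have h0 := congrFun h' 0
  have h1 := congrFun h' 1
  simp [perp] at h0 h1
  ext j; fin_cases j
  · simp; linarith
  · simp; linarith

/-- If the remaining vertices lie strictly on one side of the line through `a` and `b`, then
this line supports `L`. -/
theorem IsFacetPolygon.exists_strict_support {L : Set Pt} {W : Finset Pt}
    (hP : IsFacetPolygon L W) {a b : Pt} (hab : a ≠ b) (ha : a ∈ W) (hb : b ∈ W)
    (hsame : ∀ g : Pt, g ≠ 0 → ev g b = ev g a → ∀ c ∈ W, ∀ d ∈ W, ev g c < ev g a →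
      ev g a < ev g d → False) :
    ∃ g : Pt, g ≠ 0 ∧ ev g b = ev g a ∧ (∀ y ∈ L, ev g y ≤ ev g a) ∧
      ∀ c ∈ W, ev g c = ev g a → c = a ∨ c = b := by
  obtain ⟨hg, he⟩ := ne_zero_and_perp_of_ne hab
  set g := perp (b - a)
  have hcol : ∀ g : Pt, g ≠ 0 → ev g b = ev g a → ∀ c ∈ W, ev g c = ev g a → c = a ∨ c = b := by
    intro g hg he c hc hca
    by_contra! h
    exact extremePoints_not_collinear hg (hP.extreme a ha) (hP.extreme b hb) (hP.extreme c hc)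
      hab h.2.symm h.1.symm he.symm (by rw [he, hca])
  by_cases h : ∀ w ∈ W, ev g w ≤ ev g a
  · exact ⟨g, hg, he, fun y hy => hP.ev_le h hy, hcol g hg he⟩
  · push Not at h
    obtain ⟨d, hd, hda⟩ := h
    refine ⟨-g, neg_ne_zero.2 hg, by simp [ev_neg_left, he], fun y hy => ?_, ?_⟩
    · refine hP.ev_le (fun w hw => ?_) hy
      rw [ev_neg_left, ev_neg_left, neg_le_neg_iff]
      by_contra! hlt
      exact hsame g hg he w hw d hd hlt hda
    · exact hcol _ (neg_ne_zero.2 hg) (by simp [ev_neg_left, he])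

theorem IsFacetPolygon.isCyclicLabeling_three {L : Set Pt} {W : Finset Pt}
    (hP : IsFacetPolygon L W) {v : Fin 3 → Pt} (hinj : Function.Injective v)
    (hmem : ∀ w, w ∈ W ↔ ∃ i, v i = w) : IsCyclicLabeling L W v := by
  have hvW : ∀ i, v i ∈ W := fun i => (hmem _).2 ⟨i, rfl⟩
  refine ⟨hinj, hmem, fun i => ?_, fun x hx hxi => ?_⟩
  · have h3 : ∀ i j : Fin 3, j = i ∨ j = i + 1 ∨ j = i + 2 := by decide
    have hne : v i ≠ v (i + 1) := fun h =>
      (by decide : ∀ i : Fin 3, i ≠ i + 1) i (hinj h)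
    obtain ⟨g, hg, he, hle, heq⟩ := hP.exists_strict_support hne (hvW i) (hvW (i + 1)) (by
      intro g hg he c hc d hd h1 h2
      obtain ⟨k, rfl⟩ := (hmem c).1 hc
      obtain ⟨l, rfl⟩ := (hmem d).1 hd
      rcases h3 i k with rfl | rfl | rfl
      · linarith
      · linarith
      · rcases h3 i l with rfl | rfl | rfl <;> linarith)
    exact ⟨g, hg, hle, he, fun j hj => (heq _ (hvW j) hj).imp (fun h => hinj h) fun h => hinj h⟩
  · obtain ⟨g, hg, a, ha, b, hb, hxab, -, -⟩ := hP.exists_edge hx hxi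
    obtain ⟨i, rfl⟩ := (hmem a).1 ha
    obtain ⟨j, rfl⟩ := (hmem b).1 hb
    have h3 : ∀ i j : Fin 3, j = i ∨ j = i + 1 ∨ i = j + 1 := by decide
    rcases h3 i j with rfl | rfl | rfl
    · rw [segment_same, Set.mem_singleton_iff] at hxab
      exact ⟨j, by rw [hxab]; exact left_mem_segment _ _ _⟩
    · exact ⟨i, hxab⟩
    · exact ⟨j, by rwa [segment_symm]⟩

theorem IsFacetPolygon.isCyclicLabeling_four {L : Set Pt} {W : Finset Pt}
    (hP : IsFacetPolygon L W) {v : Fin 4 → Pt} (hinj : Function.Injective v)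
    (hmem : ∀ w, w ∈ W ↔ ∃ i, v i = w) {z : Pt} (hz1 : z ∈ segment ℝ (v 0) (v 2))
    (hz2 : z ∈ segment ℝ (v 1) (v 3)) : IsCyclicLabeling L W v := by
  have hvW : ∀ i, v i ∈ W := fun i => (hmem _).2 ⟨i, rfl⟩
  have hz : ∀ i : Fin 4, z ∈ segment ℝ (v i) (v (i + 2)) := by
    intro i
    fin_cases i
    · exact hz1
    · exact hz2
    · rw [segment_symm]; exact hz1
    · rw [segment_symm]; exact hz2
  have hznv : ∀ i, z ≠ v i := by
    intro i h
    have h1 := hz (i + 1)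
    rw [h] at h1
    have := (mem_extremePoints_iff_left.1 (hP.extreme _ (hvW i))).2
    have hd : ∀ i : Fin 4, i + 1 ≠ i ∧ i + 1 + 2 ≠ i := by decide
    have n1 : v (i + 1) ≠ v i := fun h => (hd i).1 (hinj h)
    have n2 : v (i + 1 + 2) ≠ v i := fun h => (hd i).2 (hinj h)
    exact n1 (this _ (hP.mem (hvW _)) _ (hP.mem (hvW _))
      (mem_openSegment_of_ne_left_right n1 n2 h1))
  have hzo : ∀ i : Fin 4, z ∈ openSegment ℝ (v i) (v (i + 2)) := fun i =>
    mem_openSegment_of_ne_left_right (hznv _).symm (hznv _).symm (hz i)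
  have h4 : ∀ i j : Fin 4, j = i ∨ j = i + 1 ∨ j = i + 2 ∨ j = i + 3 := by decide
  refine ⟨hinj, hmem, fun i => ?_, fun x hx hxi => ?_⟩
  · have hne : v i ≠ v (i + 1) := fun h =>
      (by decide : ∀ i : Fin 4, i ≠ i + 1) i (hinj h)
    obtain ⟨g, hg, he, hle, heq⟩ := hP.exists_strict_support hne (hvW i) (hvW (i + 1)) (by
      intro g hg he c hc d hd h1 h2
      obtain ⟨k, rfl⟩ := (hmem c).1 hc
      obtain ⟨l, rfl⟩ := (hmem d).1 hd
      obtain ⟨s, t, hs, ht, hst, e⟩ := hzo i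
      obtain ⟨s', t', hs', ht', hst', e'⟩ := hzo (i + 1)
      have e2 : ev g (s • v i + t • v (i + 2)) = ev g (s' • v (i + 1) + t' • v (i + 1 + 2)) := by
        rw [e, e']
      have h13 : i + 1 + 2 = i + 3 := (by decide : ∀ i : Fin 4, i + 1 + 2 = i + 3) i
      rw [ev_comb, ev_comb, he, h13] at e2
      have es : s = 1 - t := by linarith
      have es' : s' = 1 - t' := by linarith
      have e3 : t * (ev g (v (i + 2)) - ev g (v i)) = t' * (ev g (v (i + 3)) - ev g (v i)) := by
        rw [es, es'] at e2; linarith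
      rcases h4 i k with rfl | rfl | rfl | rfl
      · linarith
      · linarith
      · rcases h4 i l with rfl | rfl | rfl | rfl
        · linarith
        · linarith
        · linarith
        · nlinarith [mul_pos ht (sub_pos.2 h1), mul_pos ht' (sub_pos.2 h2)]
      · rcases h4 i l with rfl | rfl | rfl | rfl
        · linarith
        · linarith
        · nlinarith [mul_pos ht' (sub_pos.2 h1), mul_pos ht (sub_pos.2 h2)]
        · linarith)
    exact ⟨g, hg, hle, he, fun j hj => (heq _ (hvW j) hj).imp (fun h => hinj h) fun h => hinj h⟩
  · obtain ⟨g, hg, a, ha, b, hb, hxab, hba, hle⟩ := hP.exists_edge hx hxi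
    obtain ⟨i, rfl⟩ := (hmem a).1 ha
    obtain ⟨j, rfl⟩ := (hmem b).1 hb
    rcases h4 i j with rfl | rfl | rfl | rfl
    · rw [segment_same, Set.mem_singleton_iff] at hxab
      exact ⟨j, by rw [hxab]; exact left_mem_segment _ _ _⟩
    · exact ⟨i, hxab⟩
    · exfalso
      obtain ⟨s, t, hs, ht, hst, e⟩ := hzo i
      obtain ⟨s', t', hs', ht', hst', e'⟩ := hzo (i + 1)
      have e2 : ev g (s • v i + t • v (i + 2)) = ev g (s' • v (i + 1) + t' • v (i + 1 + 2)) := by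
        rw [e, e']
      rw [ev_comb, ev_comb, hba] at e2
      have l1 := hle _ (hP.mem (hvW (i + 1)))
      have l2 := hle _ (hP.mem (hvW (i + 1 + 2)))
      have es : s = 1 - t := by linarith
      have es' : s' = 1 - t' := by linarith
      rw [es, es'] at e2
      have k1 : ev g (v (i + 1)) = ev g (v i) := by nlinarith
      have hd : ∀ i : Fin 4, i ≠ i + 1 ∧ i + 1 ≠ i + 2 ∧ i ≠ i + 2 := by decide
      exact extremePoints_not_collinear hg (hP.extreme _ (hvW i)) (hP.extreme _ (hvW (i + 1)))
        (hP.extreme _ (hvW (i + 2))) (fun h => (hd i).1 (hinj h)) (fun h => (hd i).2.1 (hinj h))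
        (fun h => (hd i).2.2 (hinj h)) k1.symm (by rw [k1, hba])
    · refine ⟨i + 3, ?_⟩
      have : i + 3 + 1 = i := (by decide : ∀ i : Fin 4, i + 3 + 1 = i) i
      rwa [this, segment_symm]

theorem IsFacetPolygon.mem_of_mem_convexHull {L : Set Pt} {W : Finset Pt}
    (hP : IsFacetPolygon L W) {w : Pt} (hw : w ∈ W) {A : Set Pt} (hA : A ⊆ W)
    (h : w ∈ convexHull ℝ A) : w ∈ A := by
  have hsub : convexHull ℝ A ⊆ L := by rw [hP.eq_hull]; exact convexHull_mono hA
  exact extremePoints_convexHull_subset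
    (inter_extremePoints_subset_extremePoints_of_subset hsub ⟨h, hP.extreme w hw⟩)

theorem IsFacetPolygon.exists_crossing {L : Set Pt} {W : Finset Pt} (hP : IsFacetPolygon L W)
    (hcard : W.card = 4) : ∃ v : Fin 4 → Pt, Function.Injective v ∧
      (∀ w, w ∈ W ↔ ∃ i, v i = w) ∧
      ∃ z, z ∈ segment ℝ (v 0) (v 2) ∧ z ∈ segment ℝ (v 1) (v 3) := by
  classical
  let e : Fin 4 ≃ W := (W.equivFinOfCardEq hcard).symm
  let f : Fin 4 → Pt := fun i => e i
  have hfinj : Function.Injective f := fun i j h => e.injective (Subtype.ext h)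
  have hfW : ∀ i, f i ∈ W := fun i => (e i).2
  have hfmem : ∀ w, w ∈ W ↔ ∃ i, f i = w := fun w =>
    ⟨fun hw => ⟨e.symm ⟨w, hw⟩, by simp [f]⟩, by rintro ⟨i, rfl⟩; exact hfW i⟩
  have hdep : ¬ AffineIndependent ℝ f := by
    intro h
    have h1 := h.finrank_vectorSpan (n := 3) (by simp)
    have h2 := Submodule.finrank_le (vectorSpan ℝ (Set.range f))
    simp at h2
    omega
  obtain ⟨I, z, hz1, hz2⟩ := Convex.radon_partition hdep
  have hsmall : ∀ I : Set (Fin 4), z ∈ convexHull ℝ (f '' I) → z ∈ convexHull ℝ (f '' Iᶜ) →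
      ∀ i, I ⊆ {i} → False := by
    intro I hz1 hz2 i hI
    have hsub : f '' I ⊆ {f i} := by
      rintro _ ⟨j, hj, rfl⟩
      rw [Set.mem_singleton_iff, hI hj]
    have hzi : z = f i := by
      have := convexHull_mono hsub hz1
      rwa [convexHull_singleton, Set.mem_singleton_iff] at this
    have hiI : i ∈ I := by
      have hne : (f '' I).Nonempty := by rw [← convexHull_nonempty_iff (𝕜 := ℝ)]; exact ⟨z, hz1⟩
      obtain ⟨_, j, hj, -⟩ := hne
      rwa [← Set.mem_singleton_iff.1 (hI hj)]
    rw [hzi] at hz2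
    obtain ⟨j, hj, hji⟩ := hP.mem_of_mem_convexHull (hfW i)
      (by rintro _ ⟨j, -, rfl⟩; exact hfW j) hz2
    exact hj (hfinj hji ▸ hiI)
  set s : Finset (Fin 4) := I.toFinset with hs
  have hIs : I = ↑s := by simp [hs]
  have hsc : s.card + sᶜ.card = 4 := by rw [Finset.card_add_card_compl]; simp
  have hone : ∀ t : Finset (Fin 4), t.card ≤ 1 → ∃ i, (t : Set (Fin 4)) ⊆ {i} := by
    intro t ht
    obtain ⟨i, hi⟩ := Finset.card_le_one_iff_subset_singleton.1 ht
    exact ⟨i, by exact_mod_cast hi⟩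
  rw [hIs] at hz1 hz2
  rcases Nat.lt_trichotomy s.card 2 with hlt | heq | hgt
  · obtain ⟨i, hi⟩ := hone s (by omega)
    exact (hsmall _ hz1 hz2 i hi).elim
  · obtain ⟨i, j, hij, hs2⟩ := Finset.card_eq_two.1 heq
    obtain ⟨k, l, hkl, hs2'⟩ := Finset.card_eq_two.1 (show sᶜ.card = 2 by omega)
    rw [← Finset.coe_compl, hs2'] at hz2
    rw [hs2] at hz1
    simp only [Finset.coe_pair, Set.image_pair, convexHull_pair] at hz1 hz2
    have hk : k ∉ s := by rw [← Finset.mem_compl, hs2']; simp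
    have hl : l ∉ s := by rw [← Finset.mem_compl, hs2']; simp
    rw [hs2] at hk hl
    simp only [Finset.mem_insert, Finset.mem_singleton, not_or] at hk hl
    have hinj : Function.Injective ![i, k, j, l] := by
      intro a b h
      fin_cases a <;> fin_cases b <;> simp at h ⊢ <;> simp_all
    have hsurj := Finite.injective_iff_surjective.1 hinj
    refine ⟨f ∘ ![i, k, j, l], hfinj.comp hinj, fun w => ?_, z, hz1, hz2⟩
    rw [hfmem]
    constructor
    · rintro ⟨a, rfl⟩
      obtain ⟨b, hb⟩ := hsurj a
      exact ⟨b, by simp [hb]⟩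
    · rintro ⟨b, rfl⟩
      exact ⟨_, rfl⟩
  · obtain ⟨i, hi⟩ := hone sᶜ (by omega)
    rw [Finset.coe_compl] at hi
    exact (hsmall _ hz2 (by rwa [compl_compl]) i hi).elim

theorem IsFacetPolygon.exists_labeling_four {L : Set Pt} {W : Finset Pt}
    (hP : IsFacetPolygon L W) (hcard : W.card = 4) :
    ∃ v : Fin 4 → Pt, IsCyclicLabeling L W v := by
  obtain ⟨v, h1, h2, z, h3, h4⟩ := hP.exists_crossing hcard
  exact ⟨v, hP.isCyclicLabeling_four h1 h2 h3 h4⟩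

theorem IsFacetPolygon.exists_labeling_four_of_edge {L : Set Pt} {W : Finset Pt}
    (hP : IsFacetPolygon L W) (hcard : W.card = 4) {p q : Pt} (hp : p ∈ W) (hq : q ∈ W)
    (hpq : p ≠ q) {g : Pt} (hg : g ≠ 0) (he : ev g q = ev g p)
    (hle : ∀ y ∈ L, ev g y ≤ ev g p) :
    ∃ v : Fin 4 → Pt, IsCyclicLabeling L W v ∧ v 0 = p ∧ v 1 = q := by
  obtain ⟨v, hinj, hmem, z, h02, h13⟩ := hP.exists_crossing hcard
  have rot : ∀ v : Fin 4 → Pt, Function.Injective v → (∀ w, w ∈ W ↔ ∃ i, v i = w) →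
      z ∈ segment ℝ (v 0) (v 2) → z ∈ segment ℝ (v 1) (v 3) → ∀ i, ∃ v' : Fin 4 → Pt,
      Function.Injective v' ∧ (∀ w, w ∈ W ↔ ∃ i, v' i = w) ∧
      z ∈ segment ℝ (v' 0) (v' 2) ∧ z ∈ segment ℝ (v' 1) (v' 3) ∧ v' 0 = v i := by
    intro v hinj hmem h02 h13 i
    refine ⟨fun j => v (j + i), fun a b h => add_right_cancel (hinj h), fun w => ?_, ?_, ?_, ?_⟩
    · rw [hmem]
      constructor
      · rintro ⟨a, rfl⟩
        exact ⟨a - i, by simp⟩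
      · rintro ⟨a, rfl⟩
        exact ⟨_, rfl⟩
    · fin_cases i
      · exact h02
      · exact h13
      · rw [segment_symm]; exact h02
      · rw [segment_symm]; exact h13
    · fin_cases i
      · exact h13
      · rw [segment_symm]; exact h02
      · rw [segment_symm]; exact h13
      · exact h02
    · simp
  obtain ⟨i, rfl⟩ := (hmem p).1 hp
  obtain ⟨v', hinj', hmem', h02', h13', hv'⟩ := rot v hinj hmem h02 h13 i
  rw [← hv'] at hp hpq he hle
  have hlab := hP.isCyclicLabeling_four hinj' hmem' h02' h13'
  obtain ⟨j, rfl⟩ := (hmem' q).1 hq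
  have hj := (by decide : ∀ j : Fin 4, j = 0 ∨ j = 1 ∨ j = 2 ∨ j = 3) j
  rcases hj with rfl | rfl | rfl | rfl
  · exact absurd rfl hpq
  · exact ⟨v', hlab, hv', rfl⟩
  · exfalso
    have hz := IsCyclicLabeling.ev_eq_of_mem_segment he h02'
    have hz1 : z ≠ v' 1 := by
      rintro rfl
      exact extremePoints_not_collinear hg (hP.extreme _ hp) (hP.extreme _ (hlab.mem 1))
        (hP.extreme _ hq) (fun h => by simpa using hinj' h) (fun h => by simpa using hinj' h) hpq
        hz.symm (by rw [hz, he])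
    have hz3 : z ≠ v' 3 := by
      rintro rfl
      exact extremePoints_not_collinear hg (hP.extreme _ hp) (hP.extreme _ (hlab.mem 3))
        (hP.extreme _ hq) (fun h => by simpa using hinj' h) (fun h => by simpa using hinj' h) hpq
        hz.symm (by rw [hz, he])
    obtain ⟨s, t, hs, ht, hst, rfl⟩ := mem_openSegment_of_ne_left_right hz1.symm hz3.symm h13'
    rw [ev_comb] at hz
    have := (IsCyclicLabeling.eq_of_comb_eq_of_le hs ht hst (hle _ (hP.mem (hlab.mem 1)))
      (hle _ (hP.mem (hlab.mem 3))) hz).1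
    exact extremePoints_not_collinear hg (hP.extreme _ hp) (hP.extreme _ (hlab.mem 1))
      (hP.extreme _ hq) (fun h => by simpa using hinj' h) (fun h => by simpa using hinj' h) hpq
      this.symm (by rw [this, he])
  · refine ⟨fun j => v' (-j), hP.isCyclicLabeling_four (z := z)
      (fun a b h => neg_injective (hinj' h)) (fun w => ?_) h02' (by rw [segment_symm]; exact h13'),
      hv', rfl⟩
    rw [hmem']
    constructor
    · rintro ⟨a, rfl⟩
      exact ⟨-a, by simp⟩
    · rintro ⟨a, rfl⟩
      exact ⟨_, rfl⟩

theorem IsFacetPolygon.exists_labeling_three {L : Set Pt} {W : Finset Pt}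
    (hP : IsFacetPolygon L W) (hcard : W.card = 3) {p q : Pt} (hp : p ∈ W) (hq : q ∈ W)
    (hpq : p ≠ q) : ∃ v : Fin 3 → Pt, IsCyclicLabeling L W v ∧ v 0 = p ∧ v 1 = q := by
  classical
  have h1 : ((W.erase p).erase q).card = 1 := by
    rw [Finset.card_erase_of_mem (Finset.mem_erase.2 ⟨hpq.symm, hq⟩),
      Finset.card_erase_of_mem hp, hcard]
  obtain ⟨c, hc⟩ := Finset.card_eq_one.1 h1
  have hcm : c ∈ (W.erase p).erase q := by rw [hc]; simp
  simp only [Finset.mem_erase] at hcm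
  refine ⟨![p, q, c], hP.isCyclicLabeling_three ?_ fun w => ?_, rfl, rfl⟩
  · intro a b h
    fin_cases a <;> fin_cases b <;> simp at h ⊢ <;> simp_all
  · constructor
    · intro hw
      by_cases h1 : w = p
      · exact ⟨0, h1.symm⟩
      by_cases h2 : w = q
      · exact ⟨1, h2.symm⟩
      have : w ∈ (W.erase p).erase q := by simp [h1, h2, hw]
      rw [hc, Finset.mem_singleton] at this
      exact ⟨2, this.symm⟩
    · rintro ⟨a, rfl⟩
      fin_cases a
      · exact hp
      · exact hq
      · exact hcm.2.2

theorem IsCyclicLabeling.affineIndependent {L : Set Pt} {W : Finset Pt} {v : Fin 3 → Pt}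
    (hP : IsFacetPolygon L W) (hv : IsCyclicLabeling L W v) :
    AffineIndependent ℝ ![v 0, v 1, v 2] := by
  rw [affineIndependent_iff_not_collinear_set]
  intro h
  rw [collinear_iff_of_mem (p₀ := v 0) (by simp)] at h
  obtain ⟨d, hd⟩ := h
  have hne : ∀ i j : Fin 3, i ≠ j → v i ≠ v j := fun i j h h' => h (hv.injective h')
  have hd0 : perp d ≠ 0 := by
    intro h0
    have h1 := congrFun h0 0
    have h2 := congrFun h0 1
    simp [perp] at h1 h2
    obtain ⟨r, hr⟩ := hd (v 1) (by simp)
    apply hne 1 0 (by decide)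
    rw [hr]
    ext j; fin_cases j <;> simp [h1, h2]
  have hev : ∀ x ∈ ({v 0, v 1, v 2} : Set Pt), ev (perp d) x = ev (perp d) (v 0) := by
    intro x hx
    obtain ⟨r, hr⟩ := hd x hx
    rw [hr, vadd_eq_add, ev_add, ev_smul]
    simp [ev, perp]
    right; ring
  exact extremePoints_not_collinear hd0 (hP.extreme _ (hv.mem 0)) (hP.extreme _ (hv.mem 1))
    (hP.extreme _ (hv.mem 2)) (hne _ _ (by decide)) (hne _ _ (by decide)) (hne _ _ (by decide))
    (hev _ (by simp)).symm (by rw [hev (v 1) (by simp), hev (v 2) (by simp)])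

theorem IsCyclicLabeling.isQuadWith {L : Set Pt} {W : Finset Pt} {v : Fin 4 → Pt}
    (hP : IsFacetPolygon L W) (hv : IsCyclicLabeling L W v) : IsQuadWith L v := by
  refine ⟨?_, fun i => hP.extreme _ (hv.mem i), fun i z hz => ?_⟩
  · conv_lhs => rw [hP.eq_hull, hv.coe_eq_range]
  · exact ⟨subset_closure (hv.segment_subset hP _ _ hz), hv.not_mem_interior hz⟩

/-! ### Polygons all of whose edges carry at most one lattice point -/

theorem IsFacetPolygon.isCompact {L : Set Pt} {W : Finset Pt} (hP : IsFacetPolygon L W) :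
    IsCompact L := by
  rw [hP.eq_hull]; exact W.finite_toSet.isCompact_convexHull ℝ

theorem IsFacetPolygon.exists_bound {L : Set Pt} {W : Finset Pt} (hP : IsFacetPolygon L W) :
    ∃ C : ℝ, ∀ x ∈ L, ∀ j, |x j| ≤ C := by
  obtain ⟨C, hC⟩ := hP.isCompact.isBounded.exists_norm_le
  exact ⟨C, fun x hx j => (norm_le_pi_norm x j).trans (hC x hx)⟩

theorem IsFacetPolygon.finite_isIntPt {L : Set Pt} {W : Finset Pt} (hP : IsFacetPolygon L W) :
    {x | x ∈ L ∧ IsIntPt x}.Finite := by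
  obtain ⟨C, hC⟩ := hP.exists_bound
  exact (finite_isIntPt_of_abs_le C).subset fun x hx => ⟨hx.2, hC x hx.1⟩

/-- Some supporting line of `L` carries two lattice points of `L`. -/
def HasLongEdge (L : Set Pt) : Prop :=
  ∃ g : Pt, g ≠ 0 ∧ ∃ p ∈ L, ∃ q ∈ L, p ≠ q ∧ IsIntPt p ∧ IsIntPt q ∧
    (∀ y ∈ L, ev g y ≤ ev g p) ∧ ev g q = ev g p

theorem card_le_four_of_not_hasLongEdge {L : Set Pt} (hL : Convex ℝ L)
    (hi : (interior L).Nonempty) (hfree : LatticeFree L) (hno : ¬ HasLongEdge L) {X : Finset Pt}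
    (hX : ∀ x ∈ X, x ∈ L ∧ IsIntPt x) : X.card ≤ 4 := by
  classical
  let φ : Pt → Fin 2 → ZMod 2 := fun x j => ((⌊x j⌋ : ℤ) : ZMod 2)
  have hinj : Set.InjOn φ (X : Set Pt) := by
    intro p hp q hq h
    by_contra hne
    obtain ⟨hpL, hpi⟩ := hX p hp
    obtain ⟨hqL, hqi⟩ := hX q hq
    set m : Pt := (1 / 2 : ℝ) • p + (1 / 2 : ℝ) • q with hm
    have hmL : m ∈ L := hL hpL hqL (by norm_num) (by norm_num) (by norm_num)
    have hmi : IsIntPt m := by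
      intro j
      obtain ⟨a, ha⟩ := hpi j
      obtain ⟨b, hb⟩ := hqi j
      have hj : ((a : ℤ) : ZMod 2) = (b : ZMod 2) := by
        have := congrFun h j
        simpa [φ, ha, hb] using this
      rw [ZMod.intCast_eq_intCast_iff_dvd_sub] at hj
      obtain ⟨c, hc⟩ := hj
      refine ⟨a + c, ?_⟩
      have : (b : ℝ) - a = 2 * c := by exact_mod_cast hc
      simp [hm, ha, hb]
      linarith
    obtain ⟨g, hg, hs⟩ := exists_support hL hi (fun h => hfree m h hmi)
    have h1 := hs p hpL
    have h2 := hs q hqL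
    have hme : ev g m = 1 / 2 * ev g p + 1 / 2 * ev g q := ev_comb _ _ _ _ _
    refine hno ⟨g, hg, p, hpL, q, hqL, hne, hpi, hqi, fun y hy => ?_, by linarith⟩
    linarith [hs y hy]
  have := Finset.card_le_card_of_injOn φ (t := Finset.univ) (fun x _ => Finset.mem_univ _) hinj
  simpa using this

theorem IsCyclicLabeling.openSegment_of_not_hasLongEdge {L : Set Pt} {W : Finset Pt} {n : ℕ}
    [NeZero n] {v : Fin n → Pt} (hv : IsCyclicLabeling L W v) (hP : IsFacetPolygon L W)
    (hn : (1 : Fin n) ≠ 0) (hno : ¬ HasLongEdge L) {X : Finset Pt}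
    (hX : ∀ x, x ∈ X ↔ x ∈ L ∧ IsIntPt x) (hcard : n ≤ X.card) :
    (∀ i, ¬ IsIntPt (v i)) ∧
      ∀ i, ∃! z, z ∈ openSegment ℝ (v i) (v (i + 1)) ∧ IsIntPt z := by
  classical
  have huniq : ∀ i, ∀ x ∈ X, ∀ y ∈ X, x ∈ segment ℝ (v i) (v (i + 1)) →
      y ∈ segment ℝ (v i) (v (i + 1)) → x = y := by
    intro i x hx y hy hxs hys
    by_contra hne
    obtain ⟨g, hg, hle, he, -⟩ := hv.exists_side i
    have e1 := IsCyclicLabeling.ev_eq_of_mem_segment he hxs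
    have e2 := IsCyclicLabeling.ev_eq_of_mem_segment he hys
    exact hno ⟨g, hg, x, ((hX x).1 hx).1, y, ((hX y).1 hy).1, hne, ((hX x).1 hx).2,
      ((hX y).1 hy).2, by rwa [e1], by rw [e1, e2]⟩
  have hside : ∀ x : X, ∃ i, (x : Pt) ∈ segment ℝ (v i) (v (i + 1)) := fun x =>
    hv.boundary x ((hX x).1 x.2).1 fun h => hP.free x h ((hX x).1 x.2).2
  choose σ hσ using hside
  have hσinj : Function.Injective σ := fun x y h =>
    Subtype.ext (huniq (σ x) x x.2 y y.2 (hσ x) (by rw [h]; exact hσ y))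
  have hσsurj : Function.Surjective σ := by
    have : Fintype.card X = Fintype.card (Fin n) := by
      refine le_antisymm (Fintype.card_le_of_injective σ hσinj) (by simpa using hcard)
    exact ((Fintype.bijective_iff_injective_and_card σ).2 ⟨hσinj, this⟩).2
  have hvert : ∀ i, ¬ IsIntPt (v i) := by
    intro i hi
    have hviX : v i ∈ X := (hX _).2 ⟨hP.mem (hv.mem i), hi⟩
    obtain ⟨x, hx⟩ := hσsurj i
    obtain ⟨y, hy⟩ := hσsurj (i - 1)
    have hxv := huniq i x x.2 (v i) hviX (hx ▸ hσ x) (left_mem_segment _ _ _)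
    have hyv := huniq (i - 1) y y.2 (v i) hviX (hy ▸ hσ y)
      (by rw [sub_add_cancel]; exact right_mem_segment _ _ _)
    have hxy : x = y := Subtype.ext (hxv.trans hyv.symm)
    have : i = i - 1 := hx.symm.trans ((congrArg σ hxy).trans hy)
    exact hn (sub_eq_self.1 this.symm)
  refine ⟨hvert, fun i => ?_⟩
  obtain ⟨x, hx⟩ := hσsurj i
  have hxs : (x : Pt) ∈ segment ℝ (v i) (v (i + 1)) := hx ▸ hσ x
  have hxint := ((hX x).1 x.2).2
  refine ⟨x, ⟨mem_openSegment_of_ne_left_right (fun h => hvert _ (h ▸ hxint))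
    (fun h => hvert _ (h ▸ hxint)) hxs, hxint⟩, fun y hy => ?_⟩
  have hys := openSegment_subset_segment _ _ _ hy.1
  exact huniq i y ((hX y).2 ⟨hv.segment_subset hP _ _ hys, hy.2⟩) x x.2 hys hxs

theorem IsFacetPolygon.isT3_or_isQ2 {L : Set Pt} {W : Finset Pt} (hP : IsFacetPolygon L W)
    (hno : ¬ HasLongEdge L) : IsT3 L ∨ IsQ2 L := by
  classical
  set X := hP.finite_isIntPt.toFinset with hXdef
  have hX : ∀ x, x ∈ X ↔ x ∈ L ∧ IsIntPt x := by simp [hXdef]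
  have h4 : X.card ≤ 4 := card_le_four_of_not_hasLongEdge hP.convex hP.nonempty_interior hP.free
    hno fun x hx => (hX x).1 hx
  have hWX : W.card ≤ X.card := hP.card_le X (fun x hx => ((hX x).1 hx).1)
    (fun x hx h => hP.free x h ((hX x).1 hx).2) fun z hz hzi => Or.inl ((hX z).2 ⟨hz, hzi⟩)
  have h3 := hP.three_le_card
  have hcase : W.card = 3 ∨ W.card = 4 := by omega
  rcases hcase with hc | hc
  · left
    obtain ⟨p, hp, q, hq, hpq⟩ := Finset.one_lt_card.1 (show 1 < W.card by omega)
    obtain ⟨v, hv, -, -⟩ := hP.exists_labeling_three hc hp hq hpq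
    obtain ⟨hvert, hseg⟩ := hv.openSegment_of_not_hasLongEdge hP (by decide) hno hX (by omega)
    refine ⟨v 0, v 1, v 2, hv.affineIndependent hP, hvert 0, hvert 1, hvert 2, ?_, hseg 0, hseg 1,
      ?_, fun z hz hzf => ?_⟩
    · conv_lhs => rw [hP.eq_hull, hv.coe_eq_range]
      congr 1
      ext x
      simp [Fin.exists_fin_succ, eq_comm]
    · rw [openSegment_symm]; exact hseg 2
    · have hzL : z ∈ L := hP.isCompact.isClosed.closure_eq ▸ hzf.1
      obtain ⟨i, hi⟩ := hv.boundary z hzL hzf.2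
      have ho := mem_openSegment_of_ne_left_right (fun h => hvert _ (h ▸ hz))
        (fun h => hvert _ (h ▸ hz)) hi
      fin_cases i
      · exact Or.inl ho
      · exact Or.inr (Or.inl ho)
      · exact Or.inr (Or.inr (by rw [openSegment_symm]; exact ho))
  · right
    obtain ⟨v, hv⟩ := hP.exists_labeling_four hc
    obtain ⟨hvert, hseg⟩ := hv.openSegment_of_not_hasLongEdge hP (by decide) hno hX (by omega)
    exact ⟨v, hv.isQuadWith hP, hvert, hseg⟩

/-! ### Triangles whose vertices are lattice points -/

/-- A real multiple of `w` is a lattice point only if the factor is an integer. -/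
def IsPrimitiveVec (w : Pt) : Prop := ∀ t : ℝ, IsIntPt (t • w) → ∃ z : ℤ, t = z

theorem IsIntPt.add {x y : Pt} (hx : IsIntPt x) (hy : IsIntPt y) : IsIntPt (x + y) := by
  intro j
  obtain ⟨a, ha⟩ := hx j
  obtain ⟨b, hb⟩ := hy j
  exact ⟨a + b, by simp [ha, hb]⟩

theorem IsIntPt.zsmul {x : Pt} (n : ℤ) (hx : IsIntPt x) : IsIntPt ((n : ℝ) • x) := by
  intro j
  obtain ⟨a, ha⟩ := hx j
  exact ⟨n * a, by simp [ha]⟩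

theorem IsIntPt.sub {x y : Pt} (hx : IsIntPt x) (hy : IsIntPt y) : IsIntPt (x - y) := by
  intro j
  obtain ⟨a, ha⟩ := hx j
  obtain ⟨b, hb⟩ := hy j
  exact ⟨a - b, by simp [ha, hb]⟩

theorem isPrimitiveVec_of_bezout {w : Pt} {a b : ℤ} (h : a * w 0 + b * w 1 = 1) :
    IsPrimitiveVec w := by
  intro t ht
  obtain ⟨c, hc⟩ := ht 0
  obtain ⟨d, hd⟩ := ht 1
  refine ⟨a * c + b * d, ?_⟩
  simp only [Pi.smul_apply, smul_eq_mul] at hc hd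
  push_cast
  rw [← hc, ← hd]
  linear_combination -t * h

theorem IsPrimitiveVec.existsUnique_mem_openSegment {w x y : Pt} (hw : IsPrimitiveVec w)
    (hwi : IsIntPt w) (hx : IsIntPt x) (hy : y = x + (2 : ℝ) • w) :
    ∃! z, z ∈ openSegment ℝ x y ∧ IsIntPt z := by
  subst hy
  have hxw : IsIntPt (x + w) := hx.add hwi
  refine ⟨x + w, ⟨⟨1 / 2, 1 / 2, by norm_num, by norm_num, by norm_num, by module⟩, hxw⟩, ?_⟩
  rintro z ⟨⟨s, t, hs, ht, hst, rfl⟩, hz⟩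
  have hi : IsIntPt ((2 * t) • w) := by
    have e : (2 * t) • w = (s • x + t • (x + (2 : ℝ) • w)) - x := by
      obtain rfl : s = 1 - t := by linarith
      module
    rw [e]; exact hz.sub hx
  obtain ⟨n, hn⟩ := hw _ hi
  have h0 : (0 : ℝ) < n := by rw [← hn]; linarith
  have h2 : (n : ℝ) < 2 := by rw [← hn]; linarith
  have : n = 1 := by
    have h0 : 0 < n := by exact_mod_cast h0
    have h2 : n < 2 := by exact_mod_cast h2
    omega
  subst this
  obtain rfl : t = 1 / 2 := by push_cast at hn; linarith
  obtain rfl : s = 1 / 2 := by linarith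
  module

theorem affineIndependent_of_det_ne_zero {a p q : Pt} (h : p 0 * q 1 - p 1 * q 0 ≠ 0) :
    AffineIndependent ℝ ![a, a + p, a + q] := by
  rw [affineIndependent_iff_not_collinear_set, collinear_iff_of_mem (p₀ := a) (by simp)]
  rintro ⟨d, hd⟩
  obtain ⟨s, hs⟩ := hd (a + p) (by simp)
  obtain ⟨t, ht⟩ := hd (a + q) (by simp)
  rw [vadd_eq_add, add_comm, add_right_cancel_iff] at hs ht
  subst hs ht
  apply h
  simp
  ring

theorem isT1_convexHull {a p q : Pt} (ha : IsIntPt a) (hp : IsIntPt p) (hq : IsIntPt q)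
    (hpp : IsPrimitiveVec p) (hqp : IsPrimitiveVec q) (hpq : IsPrimitiveVec (q - p))
    (hdet : p 0 * q 1 - p 1 * q 0 ≠ 0) :
    IsT1 (convexHull ℝ (Set.range ![a, a + (2 : ℝ) • p, a + (2 : ℝ) • q])) := by
  have h01 := hpp.existsUnique_mem_openSegment hp ha rfl
  have h02 := hqp.existsUnique_mem_openSegment hq ha rfl
  have hp2 : IsIntPt (a + (2 : ℝ) • p) := ha.add (by exact_mod_cast hp.zsmul 2)
  have hq2 : IsIntPt (a + (2 : ℝ) • q) := ha.add (by exact_mod_cast hq.zsmul 2)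
  have h12 := hpq.existsUnique_mem_openSegment (y := a + (2 : ℝ) • q) (hq.sub hp) hp2 (by module)
  refine ⟨_, affineIndependent_of_det_ne_zero ?_, fun i => ?_, rfl, fun i j hij => ?_⟩
  · simp only [Pi.smul_apply, smul_eq_mul]
    contrapose! hdet
    linear_combination hdet / 4
  · fin_cases i
    · exact ha
    · exact hp2
    · exact hq2
  · fin_cases i <;> fin_cases j
    · exact absurd rfl hij
    · exact h01
    · exact h02
    · rw [openSegment_symm]; exact h01
    · exact absurd rfl hij
    · exact h12
    · rw [openSegment_symm]; exact h02
    · rw [openSegment_symm]; exact h12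
    · exact absurd rfl hij

theorem mem_convexHull_triangle {a p q : Pt} {s t : ℝ} (hs : 0 ≤ s) (ht : 0 ≤ t)
    (hst : s + t ≤ 2) :
    a + s • p + t • q ∈ convexHull ℝ (Set.range ![a, a + (2 : ℝ) • p, a + (2 : ℝ) • q]) := by
  set S := Set.range ![a, a + (2 : ℝ) • p, a + (2 : ℝ) • q]
  have hm : ∀ i, ![a, a + (2 : ℝ) • p, a + (2 : ℝ) • q] i ∈ convexHull ℝ S := fun i =>
    subset_convexHull ℝ S ⟨i, rfl⟩
  have := (convex_convexHull ℝ S).sum_mem (t := Finset.univ)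
    (w := ![1 - (s + t) / 2, s / 2, t / 2])
    (fun i _ => by fin_cases i <;> simp <;> linarith)
    (by simp [Fin.sum_univ_three]; ring) fun i _ => hm i
  rw [Fin.sum_univ_three] at this
  convert this using 1
  simp only [Matrix.cons_val_zero, Matrix.cons_val_one, Matrix.cons_val]
  module

/-- Every bounded set of the plane lies in a triangle of type `T¹`. -/
theorem exists_isT1_of_bounded (C : ℝ) : ∃ T, IsT1 T ∧ ∀ x : Pt, (∀ j, |x j| ≤ C) → x ∈ T := by
  obtain ⟨n, hn⟩ := exists_nat_ge (max C 1)
  have hn1 : (1 : ℝ) ≤ n := (le_max_right _ _).trans hn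
  have hnC : C ≤ n := (le_max_left _ _).trans hn
  set K : ℝ := 3 * n with hK
  have hKz : K = ((3 * n : ℤ) : ℝ) := by simp [hK]
  have hD : 0 < K * (K + 1) - 1 := by nlinarith
  set a : Pt := ![-2 * n, -2 * n]
  set p : Pt := ![K, 1]
  set q : Pt := ![1, K + 1]
  have hT : IsT1 (convexHull ℝ (Set.range ![a, a + (2 : ℝ) • p, a + (2 : ℝ) • q])) := by
    refine isT1_convexHull ?_ ?_ ?_ ?_ ?_ ?_ ?_
    · intro j; refine ⟨-2 * n, ?_⟩; fin_cases j <;> simp [a]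
    · intro j; fin_cases j
      · exact ⟨_, hKz⟩
      · exact ⟨1, by simp [p]⟩
    · intro j; fin_cases j
      · exact ⟨1, by simp [q]⟩
      · exact ⟨3 * n + 1, by simp [q, hK]⟩
    · exact isPrimitiveVec_of_bezout (a := 0) (b := 1) (by simp [p])
    · exact isPrimitiveVec_of_bezout (a := 1) (b := 0) (by simp [q])
    · exact isPrimitiveVec_of_bezout (a := 1) (b := 1) (by simp [p, q])
    · simp [p, q]; linarith
  refine ⟨_, hT, fun x hx => ?_⟩
  have h0 := abs_le.1 ((hx 0).trans hnC)
  have h1 := abs_le.1 ((hx 1).trans hnC)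
  have e : x = a + (((x 0 + 2 * n) * (K + 1) - (x 1 + 2 * n)) / (K * (K + 1) - 1)) • p +
      ((K * (x 1 + 2 * n) - (x 0 + 2 * n)) / (K * (K + 1) - 1)) • q := by
    ext j
    fin_cases j
    · simp [a, p, q]; field_simp; ring
    · simp [a, p, q]; field_simp; ring
  rw [e]
  refine mem_convexHull_triangle (div_nonneg ?_ hD.le) (div_nonneg ?_ hD.le) ?_
  · nlinarith
  · nlinarith
  · rw [← add_div, div_le_iff₀ hD]
    nlinarith

/-! ### Lattice frames -/

/-- An origin and a basis of the lattice `ℤ²`. -/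
structure LatticeFrame where
  origin : Pt
  fst : Pt
  snd : Pt
  isIntPt_origin : IsIntPt origin
  isIntPt_fst : IsIntPt fst
  isIntPt_snd : IsIntPt snd
  det : ℤ
  det_sq : (det : ℝ) * det = 1
  det_eq : fst 0 * snd 1 - fst 1 * snd 0 = det

namespace LatticeFrame

variable (F : LatticeFrame)

/-- The point with given coordinates. -/
def pt (a b : ℝ) : Pt := F.origin + a • F.fst + b • F.snd

/-- The gradient of the first coordinate. -/
def gradX : Pt := ![F.det * F.snd 1, -(F.det * F.snd 0)]

/-- The gradient of the second coordinate. -/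
def gradY : Pt := ![-(F.det * F.fst 1), F.det * F.fst 0]

/-- The first coordinate. -/
def X (x : Pt) : ℝ := ev F.gradX (x - F.origin)

/-- The second coordinate. -/
def Y (x : Pt) : ℝ := ev F.gradY (x - F.origin)

@[simp] theorem X_pt (a b : ℝ) : F.X (F.pt a b) = a := by
  simp only [X, pt, ev, gradX, Matrix.cons_val_zero, Matrix.cons_val_one, Pi.add_apply,
    Pi.sub_apply, Pi.smul_apply, smul_eq_mul]
  linear_combination a * F.det * F.det_eq + a * F.det_sq

@[simp] theorem Y_pt (a b : ℝ) : F.Y (F.pt a b) = b := by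
  simp only [Y, pt, ev, gradY, Matrix.cons_val_zero, Matrix.cons_val_one, Pi.add_apply,
    Pi.sub_apply, Pi.smul_apply, smul_eq_mul]
  linear_combination b * F.det * F.det_eq + b * F.det_sq

@[simp] theorem pt_X_Y (x : Pt) : F.pt (F.X x) (F.Y x) = x := by
  have h : ∀ t : ℝ, (F.fst 0 * F.snd 1 - F.fst 1 * F.snd 0) * F.det * t = t := fun t => by
    rw [F.det_eq, F.det_sq, one_mul]
  ext j
  simp only [X, Y, pt, ev, gradX, gradY, Matrix.cons_val_zero, Matrix.cons_val_one, Pi.add_apply,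
    Pi.sub_apply, Pi.smul_apply, smul_eq_mul]
  fin_cases j
  · simp only [Fin.zero_eta, Fin.isValue]
    linear_combination h (x 0 - F.origin 0)
  · simp only [Fin.mk_one, Fin.isValue]
    linear_combination h (x 1 - F.origin 1)

theorem ext_pt {x y : Pt} (hX : F.X x = F.X y) (hY : F.Y x = F.Y y) : x = y := by
  rw [← F.pt_X_Y x, ← F.pt_X_Y y, hX, hY]

theorem X_comb {a b : ℝ} (h : a + b = 1) (x y : Pt) :
    F.X (a • x + b • y) = a * F.X x + b * F.X y := by
  obtain rfl : a = 1 - b := by linarith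
  simp only [X, ev_sub, ev_comb]; ring

theorem Y_comb {a b : ℝ} (h : a + b = 1) (x y : Pt) :
    F.Y (a • x + b • y) = a * F.Y x + b * F.Y y := by
  obtain rfl : a = 1 - b := by linarith
  simp only [Y, ev_sub, ev_comb]; ring

theorem pt_comb {a b : ℝ} (h : a + b = 1) (x y z w : ℝ) :
    a • F.pt x y + b • F.pt z w = F.pt (a * x + b * z) (a * y + b * w) :=
  F.ext_pt (by simp [F.X_comb h]) (by simp [F.Y_comb h])

theorem isIntPt_pt (m n : ℤ) : IsIntPt (F.pt m n) :=
  (F.isIntPt_origin.add (F.isIntPt_fst.zsmul m)).add (F.isIntPt_snd.zsmul n)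

theorem exists_pt_of_isIntPt {x : Pt} (hx : IsIntPt x) : ∃ m n : ℤ, x = F.pt m n := by
  have h := hx.sub F.isIntPt_origin
  obtain ⟨a, ha⟩ := h 0
  obtain ⟨b, hb⟩ := h 1
  obtain ⟨u, hu⟩ := F.isIntPt_fst 0
  obtain ⟨u', hu'⟩ := F.isIntPt_fst 1
  obtain ⟨v, hv⟩ := F.isIntPt_snd 0
  obtain ⟨v', hv'⟩ := F.isIntPt_snd 1
  refine ⟨F.det * v' * a - F.det * v * b, -(F.det * u' * a) + F.det * u * b, ?_⟩
  rw [← F.pt_X_Y x]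
  congr 1
  · simp [X, ev, gradX, ha, hb, hv, hv', -Pi.sub_apply]; ring
  · simp [Y, ev, gradY, ha, hb, hu, hu', -Pi.sub_apply]

theorem gradY_ne_zero : F.gradY ≠ 0 := by
  intro h
  have h1 := F.Y_pt 0 1
  rw [Y, h] at h1
  simp [ev] at h1

theorem ev_gradY (x : Pt) : ev F.gradY x = F.Y x + ev F.gradY F.origin := by
  simp [Y, ev_sub]

/-- Supporting lines in coordinates. -/
theorem exists_support {L : Set Pt} (hL : Convex ℝ L) (hi : (interior L).Nonempty) {a b : ℝ}
    (hx : F.pt a b ∉ interior L) : ∃ p q : ℝ, (p ≠ 0 ∨ q ≠ 0) ∧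
      ∀ y ∈ L, p * (F.X y - a) + q * (F.Y y - b) ≤ 0 := by
  obtain ⟨g, hg, h⟩ := _root_.exists_support hL hi hx
  refine ⟨ev g F.fst, ev g F.snd, ?_, fun y hy => ?_⟩
  · by_contra! h0
    apply hg
    have e : ∀ z, ev g z = ev g F.origin := fun z => by
      rw [← F.pt_X_Y z, pt, ev_add, ev_add, ev_smul, ev_smul, h0.1, h0.2]; ring
    have e0 : ev g F.origin = 0 := by rw [← e 0]; simp [ev]
    have h0 := e (Pi.single 0 1)
    have h1 := e (Pi.single 1 1)
    simp [ev] at h0 h1 e0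
    rw [e0] at h0 h1
    ext j; fin_cases j <;> simp [h0, h1]
  · have := h y hy
    rw [← F.pt_X_Y y, pt, pt, ev_add, ev_add, ev_add, ev_add, ev_smul, ev_smul, ev_smul,
      ev_smul] at this
    linarith

theorem isSplitSet_strip : IsSplitSet {x | 0 ≤ F.Y x ∧ F.Y x ≤ 1} := by
  obtain ⟨u, hu⟩ := F.isIntPt_fst 0
  obtain ⟨u', hu'⟩ := F.isIntPt_fst 1
  obtain ⟨c, hc⟩ := F.isIntPt_origin 0
  obtain ⟨c', hc'⟩ := F.isIntPt_origin 1
  refine ⟨![-(F.det * u'), F.det * u], -(F.det * u') * c + F.det * u * c', fun h => ?_, ?_⟩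
  · apply F.gradY_ne_zero
    have h0 := congrFun h 0
    have h1 := congrFun h 1
    simp only [Matrix.cons_val_zero, Matrix.cons_val_one, Pi.zero_apply] at h0 h1
    have h0 : -((F.det : ℝ) * u') = 0 := by exact_mod_cast h0
    have h1 : (F.det : ℝ) * u = 0 := by exact_mod_cast h1
    ext j; fin_cases j
    · simpa [gradY, hu'] using h0
    · simpa [gradY, hu] using h1
  · ext x
    simp only [Set.mem_ofPred_eq, Fin.sum_univ_two, Matrix.cons_val_zero, Matrix.cons_val_one, Y,
      ev, gradY, Pi.sub_apply, hu, hu', hc, hc']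
    push_cast
    constructor <;> rintro ⟨h1, h2⟩ <;> constructor <;> linarith

/-- The frame with the two axes interchanged. -/
def swap : LatticeFrame where
  origin := F.origin
  fst := F.snd
  snd := F.fst
  isIntPt_origin := F.isIntPt_origin
  isIntPt_fst := F.isIntPt_snd
  isIntPt_snd := F.isIntPt_fst
  det := -F.det
  det_sq := by push_cast; linear_combination F.det_sq
  det_eq := by push_cast; linear_combination -F.det_eq

theorem swap_pt (a b : ℝ) : F.swap.pt a b = F.pt b a := by
  simp only [pt, swap]; abel

theorem swap_Y (x : Pt) : F.swap.Y x = F.X x := by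
  conv_lhs => rw [← F.pt_X_Y x, ← F.swap_pt, Y_pt]

/-- The frame whose second axis is sheared along the first. -/
def shear (a : ℤ) : LatticeFrame where
  origin := F.origin
  fst := F.fst
  snd := (a : ℝ) • F.fst + F.snd
  isIntPt_origin := F.isIntPt_origin
  isIntPt_fst := F.isIntPt_fst
  isIntPt_snd := (F.isIntPt_fst.zsmul a).add F.isIntPt_snd
  det := F.det
  det_sq := F.det_sq
  det_eq := by
    simp only [Pi.add_apply, Pi.smul_apply, smul_eq_mul]
    linear_combination F.det_eq

theorem shear_pt (c : ℤ) (a b : ℝ) : (F.shear c).pt a b = F.pt (a + c * b) b := by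
  simp only [pt, shear]; module

theorem shear_Y (c : ℤ) (x : Pt) : (F.shear c).Y x = F.Y x := by
  have : x = (F.shear c).pt (F.X x - c * F.Y x) (F.Y x) := by
    rw [shear_pt, sub_add_cancel, pt_X_Y]
  conv_lhs => rw [this, Y_pt]

/-- The frame reflected so that the first two lattice points of the first axis change places. -/
def flip : LatticeFrame where
  origin := F.origin + F.fst
  fst := -F.fst
  snd := F.snd
  isIntPt_origin := F.isIntPt_origin.add F.isIntPt_fst
  isIntPt_fst := by simpa using F.isIntPt_fst.zsmul (-1)
  isIntPt_snd := F.isIntPt_snd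
  det := -F.det
  det_sq := by push_cast; linear_combination F.det_sq
  det_eq := by
    simp only [Pi.neg_apply]
    push_cast; linear_combination -F.det_eq

theorem flip_pt (a b : ℝ) : F.flip.pt a b = F.pt (1 - a) b := by
  simp only [pt, flip]; module

theorem flip_Y (x : Pt) : F.flip.Y x = F.Y x := by
  have : x = F.flip.pt (1 - F.X x) (F.Y x) := by
    rw [flip_pt, sub_sub_cancel, pt_X_Y]
  conv_lhs => rw [this, Y_pt]

end LatticeFrame

theorem isPrimitiveVec_of_frame {u v : Pt} {d : ℤ} (hv : IsIntPt v) (hd : (d : ℝ) * d = 1)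
    (h : u 0 * v 1 - u 1 * v 0 = d) : IsPrimitiveVec u := by
  obtain ⟨a, ha⟩ := hv 0
  obtain ⟨b, hb⟩ := hv 1
  refine isPrimitiveVec_of_bezout (a := d * b) (b := -(d * a)) ?_
  push_cast
  rw [← ha, ← hb]
  linear_combination d * h + hd

/-- The standard lattice triangle of a frame is of type `T¹`. -/
theorem LatticeFrame.isT1 (F : LatticeFrame) :
    IsT1 (convexHull ℝ (Set.range ![F.origin, F.origin + (2 : ℝ) • F.fst,
      F.origin + (2 : ℝ) • F.snd])) := by
  have hd : (F.det : ℝ) ≠ 0 := fun h => by simpa [h] using F.det_sq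
  have hd' : ((-F.det : ℤ) : ℝ) * (-F.det : ℤ) = 1 := by
    push_cast; linear_combination F.det_sq
  refine isT1_convexHull F.isIntPt_origin F.isIntPt_fst F.isIntPt_snd
    (isPrimitiveVec_of_frame F.isIntPt_snd F.det_sq F.det_eq)
    (isPrimitiveVec_of_frame F.isIntPt_fst hd' ?_)
    (isPrimitiveVec_of_frame F.isIntPt_fst hd' ?_) (by rw [F.det_eq]; exact hd)
  · push_cast; linear_combination -F.det_eq
  · simp only [Pi.sub_apply]
    push_cast; linear_combination -F.det_eq

/-- A long edge spans the first axis of some frame with `L` in the upper half-plane. -/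
theorem HasLongEdge.exists_frame {L : Set Pt} (hL : Convex ℝ L) (h : HasLongEdge L) :
    ∃ F : LatticeFrame, F.pt 0 0 ∈ L ∧ F.pt 1 0 ∈ L ∧ ∀ y ∈ L, 0 ≤ F.Y y := by
  obtain ⟨g, hg, p, hp, q, hq, hpq, hpi, hqi, hle, he⟩ := h
  have hw := hqi.sub hpi
  obtain ⟨A, hA⟩ := hw 0
  obtain ⟨B, hB⟩ := hw 1
  have hd0 : A.gcd B ≠ 0 := by
    intro h0
    rw [Int.gcd_eq_zero_iff] at h0
    apply hpq
    simp only [Pi.sub_apply, h0.1, h0.2, Int.cast_zero] at hA hB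
    ext j; fin_cases j
    · exact (sub_eq_zero.1 hA).symm
    · exact (sub_eq_zero.1 hB).symm
  obtain ⟨a, ha⟩ := Int.gcd_dvd_left A B
  obtain ⟨b, hb⟩ := Int.gcd_dvd_right A B
  set d := A.gcd B with hd
  have hbez : a * A.gcdA B + b * A.gcdB B = 1 := by
    have h1 := Int.gcd_eq_gcd_ab A B
    rw [← hd] at h1
    have h2 : (d : ℤ) ≠ 0 := by exact_mod_cast hd0
    apply mul_left_cancel₀ h2
    linear_combination -h1 - A.gcdA B * ha - A.gcdB B * hb
  set s := A.gcdA B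
  set t := A.gcdB B
  have hbez' : (a : ℝ) * s + b * t = 1 := by exact_mod_cast hbez
  have hd1 : (1 : ℝ) ≤ d := by exact_mod_cast Nat.one_le_iff_ne_zero.2 hd0
  set u : Pt := ![a, b] with hu
  have hqu : q = p + (d : ℝ) • u := by
    have hA' : (A : ℝ) = d * a := by exact_mod_cast ha
    have hB' : (B : ℝ) = d * b := by exact_mod_cast hb
    simp only [Pi.sub_apply] at hA hB
    ext j; fin_cases j
    · simp [hu]; linarith
    · simp [hu]; linarith
  have hui : IsIntPt u := by intro j; fin_cases j <;> simp [hu]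
  have hpuL : p + u ∈ L := by
    have := hL hp hq (a := 1 - (d : ℝ)⁻¹) (b := (d : ℝ)⁻¹)
      (sub_nonneg.2 (inv_le_one_of_one_le₀ hd1)) (by positivity) (by ring)
    convert this using 1
    rw [hqu, smul_add, smul_smul, inv_mul_cancel₀ (by linarith)]
    module
  have hgu : ev g u = 0 := by
    rw [hqu, ev_add, ev_smul] at he
    have : (d : ℝ) * ev g u = 0 := by linarith
    exact (mul_eq_zero.1 this).resolve_left (by linarith)
  have key : ∀ ε : ℤ, ε * ε = 1 → ev g ![-(ε * t), ε * s] ≤ 0 →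
      ∃ F : LatticeFrame, F.pt 0 0 ∈ L ∧ F.pt 1 0 ∈ L ∧ ∀ y ∈ L, 0 ≤ F.Y y := by
    intro ε hε hv
    have hε' : (ε : ℝ) * ε = 1 := by exact_mod_cast hε
    set v : Pt := ![-(ε * t), ε * s] with hvdef
    let F : LatticeFrame :=
      { origin := p
        fst := u
        snd := v
        isIntPt_origin := hpi
        isIntPt_fst := hui
        isIntPt_snd := by
          intro j; fin_cases j
          · exact ⟨-(ε * t), by simp [hvdef]⟩
          · exact ⟨ε * s, by simp [hvdef]⟩
        det := ε
        det_sq := hε'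
        det_eq := by
          simp only [hu, hvdef, Matrix.cons_val_zero, Matrix.cons_val_one]
          linear_combination ε * hbez' }
    have hFe : ∀ y, ev g y = ev g p + F.Y y * ev g v := fun y => by
      conv_lhs => rw [← F.pt_X_Y y, LatticeFrame.pt, ev_add, ev_add, ev_smul, ev_smul]
      change ev g p + F.X y * ev g u + F.Y y * ev g v = _
      rw [hgu]; ring
    have hv0 : ev g v ≠ 0 := by
      intro h0
      apply hg
      have h1 := fun y => (hFe y).trans (by rw [h0, mul_zero, add_zero])
      have e0 := h1 0
      have e1 := h1 (Pi.single 0 1)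
      have e2 := h1 (Pi.single 1 1)
      rw [← e0] at e1 e2
      simp [ev] at e1 e2
      ext j; fin_cases j <;> simp [e1, e2]
    refine ⟨F, by simpa [LatticeFrame.pt, F] using hp, by simpa [LatticeFrame.pt, F] using hpuL,
      fun y hy => ?_⟩
    have := hle y hy
    rw [hFe y] at this
    by_contra! hlt
    have := mul_pos_of_neg_of_neg hlt (lt_of_le_of_ne hv hv0)
    linarith
  rcases le_total (ev g ![-((1 : ℤ) * t), (1 : ℤ) * s]) 0 with h1 | h1
  · exact key 1 rfl h1
  · refine key (-1) rfl ?_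
    simp only [ev, Matrix.cons_val_zero, Matrix.cons_val_one] at h1 ⊢
    push_cast at h1 ⊢
    linarith

/-! ### Polygons with a long edge -/

theorem IsFacetPolygon.mem_convexHull_of_support {L : Set Pt} {W : Finset Pt}
    (hP : IsFacetPolygon L W) {g : Pt} {c : ℝ} (hle : ∀ y ∈ L, ev g y ≤ c) {z : Pt} (hz : z ∈ L)
    (hc : ev g z = c) : z ∈ convexHull ℝ {w | w ∈ W ∧ ev g w = c} := by
  classical
  have hz' := hz
  rw [hP.eq_hull, Finset.mem_convexHull'] at hz'
  obtain ⟨l, hl, h1, rfl⟩ := hz'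
  have hw := ev_eq_of_weight_ne_zero (fun w hw => hle w (hP.mem hw)) hl h1 hc.ge
  have e1 : ∑ w ∈ W with l w ≠ 0, l w • w = ∑ w ∈ W, l w • w :=
    Finset.sum_filter_of_ne fun w _ h h0 => h (by rw [h0, zero_smul])
  have e2 : ∑ w ∈ W with l w ≠ 0, l w = ∑ w ∈ W, l w := Finset.sum_filter_of_ne fun w _ h => h
  rw [← e1]
  refine (convex_convexHull ℝ _).sum_mem (fun w hw' => hl w (Finset.mem_filter.1 hw').1)
    (e2.trans h1) fun w hw' => ?_
  have := Finset.mem_filter.1 hw'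
  exact subset_convexHull ℝ _ ⟨this.1, hw w this.1 this.2⟩

/-- The first axis of `F` carries a long edge of `L`, and `L` has no lattice points above
height `1` although it reaches beyond that height. -/
structure IsBaseFrame (L : Set Pt) (F : LatticeFrame) : Prop where
  zero_mem : F.pt 0 0 ∈ L
  one_mem : F.pt 1 0 ∈ L
  nonneg : ∀ y ∈ L, 0 ≤ F.Y y
  le_one : ∀ m n : ℤ, F.pt m n ∈ L → n ≤ 1
  exists_high : ∃ y ∈ L, 1 < F.Y y

namespace IsBaseFrame

variable {L : Set Pt} {F : LatticeFrame} {W : Finset Pt}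

theorem gradY_le (hF : IsBaseFrame L F) {x : Pt} (hx : F.Y x = 0) :
    ∀ y ∈ L, ev (-F.gradY) y ≤ ev (-F.gradY) x := by
  intro y hy
  rw [ev_neg_left, ev_neg_left, F.ev_gradY, F.ev_gradY x, hx]
  linarith [hF.nonneg y hy]

theorem ev_gradY_eq {x y : Pt} (h : F.Y x = F.Y y) : ev (-F.gradY) x = ev (-F.gradY) y := by
  rw [ev_neg_left, ev_neg_left, F.ev_gradY, F.ev_gradY y, h]

theorem Y_eq_of_ev {x y : Pt} (h : ev (-F.gradY) x = ev (-F.gradY) y) : F.Y x = F.Y y := by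
  rw [ev_neg_left, ev_neg_left, F.ev_gradY, F.ev_gradY y] at h
  linarith

theorem mem_segment (hF : IsBaseFrame L F) (hP : IsFacetPolygon L W) {a b z : Pt} (ha : a ∈ W)
    (hb : b ∈ W) (hab : a ≠ b) (ha0 : F.Y a = 0) (hb0 : F.Y b = 0) (hz : z ∈ L)
    (hz0 : F.Y z = 0) : z ∈ segment ℝ a b := by
  have h := hP.mem_convexHull_of_support (hF.gradY_le ha0) hz (ev_gradY_eq (hz0.trans ha0.symm))
  rw [← convexHull_pair]
  refine convexHull_mono (fun w hw => ?_) h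
  by_contra hne
  simp only [Set.mem_insert_iff, Set.mem_singleton_iff, not_or] at hne
  exact extremePoints_not_collinear (neg_ne_zero.2 F.gradY_ne_zero) (hP.extreme _ ha)
    (hP.extreme _ hb) (hP.extreme _ hw.1) hab (Ne.symm hne.2) (Ne.symm hne.1)
    (ev_gradY_eq (ha0.trans hb0.symm)) (by rw [hw.2, ev_gradY_eq (hb0.trans ha0.symm)])

theorem exists_base (hF : IsBaseFrame L F) (hP : IsFacetPolygon L W) :
    ∃ a ∈ W, ∃ b ∈ W, a ≠ b ∧ F.Y a = 0 ∧ F.Y b = 0 := by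
  by_contra! h
  set S : Set Pt := {w | w ∈ W ∧ ev (-F.gradY) w = ev (-F.gradY) (F.pt 0 0)}
  have hS : ∀ w ∈ S, w ∈ W ∧ F.Y w = 0 := fun w hw =>
    ⟨hw.1, by rw [Y_eq_of_ev hw.2, F.Y_pt]⟩
  have hle := hF.gradY_le (x := F.pt 0 0) (by simp)
  have h0 := hP.mem_convexHull_of_support hle hF.zero_mem rfl
  have h1 := hP.mem_convexHull_of_support hle hF.one_mem (ev_gradY_eq (by simp))
  have hsub : S.Subsingleton := fun x hx y hy => by
    by_contra hne
    exact h x (hS x hx).1 y (hS y hy).1 hne (hS x hx).2 (hS y hy).2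
  have hconv : convexHull ℝ S = S := hsub.convex.convexHull_eq
  rw [hconv] at h0 h1
  have := congrArg F.X (hsub h0 h1)
  simp at this

theorem not_isIntPt_of_one_lt (hF : IsBaseFrame L F) {c : Pt} (hc : c ∈ L) (h : 1 < F.Y c) :
    ¬ IsIntPt c := by
  intro hi
  obtain ⟨m, n, rfl⟩ := F.exists_pt_of_isIntPt hi
  rw [F.Y_pt] at h
  have := hF.le_one m n hc
  have : (n : ℝ) ≤ 1 := by exact_mod_cast this
  linarith

theorem Y_of_isIntPt (hF : IsBaseFrame L F) {z : Pt} (hz : z ∈ L) (hi : IsIntPt z) :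
    F.Y z = 0 ∨ F.Y z = 1 := by
  obtain ⟨m, n, rfl⟩ := F.exists_pt_of_isIntPt hi
  have h1 := hF.le_one m n hz
  have h0 := hF.nonneg _ hz
  rw [F.Y_pt] at h0 ⊢
  have h0 : 0 ≤ n := by exact_mod_cast h0
  have : n = 0 ∨ n = 1 := by omega
  rcases this with rfl | rfl <;> simp

theorem existsUnique_of_exists (hF : IsBaseFrame L F) (hL : Convex ℝ L) {c a : Pt} (hc : c ∈ L)
    (ha : a ∈ L) (ha0 : F.Y a = 0) (hc1 : 1 < F.Y c)
    (h : ∃ z, z ∈ openSegment ℝ c a ∧ IsIntPt z) : ∃! z, z ∈ openSegment ℝ c a ∧ IsIntPt z := by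
  have key : ∀ {s t : ℝ}, 0 < s → 0 < t → s + t = 1 → IsIntPt (s • c + t • a) →
      s * F.Y c = 1 := by
    intro s t hs ht hst hi
    have h := hF.Y_of_isIntPt (hL hc ha hs.le ht.le hst) hi
    rw [F.Y_comb hst, ha0, mul_zero, add_zero] at h
    exact h.resolve_left (mul_pos hs (by linarith)).ne'
  obtain ⟨z, hz, hzi⟩ := h
  refine ⟨z, ⟨hz, hzi⟩, ?_⟩
  obtain ⟨s, t, hs, ht, hst, rfl⟩ := hz
  rintro y ⟨⟨s', t', hs', ht', hst', rfl⟩, hyi⟩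
  have e := (key hs' ht' hst' hyi).trans (key hs ht hst hzi).symm
  obtain rfl := mul_right_cancel₀ (by linarith) e
  obtain rfl : t' = t := by linarith
  rfl

theorem isT2_of_labeling (hF : IsBaseFrame L F) (hP : IsFacetPolygon L W) {v : Fin 3 → Pt}
    (hv : IsCyclicLabeling L W v) (h0 : 1 < F.Y (v 0)) (h1 : F.Y (v 1) = 0) (h2 : F.Y (v 2) = 0)
    (h : ∃ z, z ∈ openSegment ℝ (v 0) (v 1) ∧ IsIntPt z) : IsT2A L ∨ IsT2B L := by
  have hL : ∀ i, v i ∈ L := fun i => hP.mem (hv.mem i)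
  have hull : L = convexHull ℝ {v 0, v 1, v 2} := by
    conv_lhs => rw [hP.eq_hull, hv.coe_eq_range]
    congr 1
    ext x
    simp [Fin.exists_fin_succ, eq_comm]
  have hseg : ∀ z ∈ L, F.Y z = 0 → z ∈ segment ℝ (v 1) (v 2) := fun z hz hz0 =>
    hF.mem_segment hP (hv.mem 1) (hv.mem 2) (fun h => by simpa using hv.injective h) h1 h2 hz hz0
  have hbase : ∃ z1 z2 : Pt, z1 ≠ z2 ∧ IsIntPt z1 ∧ IsIntPt z2 ∧
      z1 ∈ segment ℝ (v 1) (v 2) ∧ z2 ∈ segment ℝ (v 1) (v 2) := by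
    refine ⟨F.pt 0 0, F.pt 1 0, fun h => ?_, by exact_mod_cast F.isIntPt_pt 0 0,
      by exact_mod_cast F.isIntPt_pt 1 0, hseg _ hF.zero_mem (by simp),
      hseg _ hF.one_mem (by simp)⟩
    have := congrArg F.X h
    simp at this
  have huniq := hF.existsUnique_of_exists hP.convex (hL 0) (hL 1) h1 h0 h
  by_cases h' : ∃ z, z ∈ openSegment ℝ (v 0) (v 2) ∧ IsIntPt z
  · exact Or.inl ⟨v 0, v 1, v 2, hv.affineIndependent hP, hF.not_isIntPt_of_one_lt (hL 0) h0,
      hull, hbase, huniq, hF.existsUnique_of_exists hP.convex (hL 0) (hL 2) h2 h0 h'⟩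
  · push Not at h'
    exact Or.inr ⟨v 0, v 1, v 2, hv.affineIndependent hP, hF.not_isIntPt_of_one_lt (hL 0) h0,
      hull, hbase, huniq, h'⟩

theorem isT2 (hF : IsBaseFrame L F) (hP : IsFacetPolygon L W) (hcard : W.card = 3) {A : Pt}
    (hA : A ∈ L) (hAi : IsIntPt A) (hA1 : F.Y A = 1) : IsT2A L ∨ IsT2B L := by
  obtain ⟨a, ha, b, hb, hab, ha0, hb0⟩ := hF.exists_base hP
  obtain ⟨v, hv, rfl, rfl⟩ := hP.exists_labeling_three hcard ha hb hab
  have h2 : 1 < F.Y (v 2) := by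
    by_contra! hle
    obtain ⟨y, hy, hy1⟩ := hF.exists_high
    have := hP.ev_le (g := F.gradY) (c := 1 + ev F.gradY F.origin) (fun w hw => ?_) hy
    · rw [F.ev_gradY] at this
      linarith
    · rw [F.ev_gradY]
      obtain ⟨i, rfl⟩ := (hv.mem_iff w).1 hw
      fin_cases i
      · simp [ha0]
      · simp [hb0]
      · simpa using hle
  have hne : ∀ i, A ≠ v i := by
    rintro i rfl
    fin_cases i
    · simp [ha0] at hA1
    · simp [hb0] at hA1
    · simp at hA1; linarith
  have main : ∀ i j : Fin 3, i ≠ 2 → j ≠ 2 → i ≠ j → F.Y (v i) = 0 → F.Y (v j) = 0 →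
      A ∈ segment ℝ (v 2) (v i) → IsT2A L ∨ IsT2B L := by
    intro i j hi hj hij hi0 hj0 hAs
    obtain ⟨v', hv', e0, e1⟩ := hP.exists_labeling_three hcard (hv.mem 2) (hv.mem i)
      (fun h => hi (hv.injective h).symm)
    obtain ⟨l, hl⟩ := (hv'.mem_iff (v j)).1 (hv.mem j)
    have hl2 : l = 2 := by
      have := (by decide : ∀ l : Fin 3, l = 0 ∨ l = 1 ∨ l = 2) l
      rcases this with rfl | rfl | rfl
      · exact absurd (hv.injective (hl.symm.trans e0)) hj
      · exact absurd (hv.injective (hl.symm.trans e1)) hij.symm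
      · rfl
    subst hl2
    refine hF.isT2_of_labeling hP hv' (by rwa [e0]) (by rwa [e1]) (by rwa [hl]) ⟨A, ?_, hAi⟩
    rw [e0, e1]
    exact mem_openSegment_of_ne_left_right (hne 2).symm (hne i).symm hAs
  obtain ⟨i, hi⟩ := hv.boundary A hA fun h => hP.free A h hAi
  have := (by decide : ∀ l : Fin 3, l = 0 ∨ l = 1 ∨ l = 2) i
  rcases this with rfl | rfl | rfl
  · exfalso
    obtain ⟨s, t, -, -, hst, rfl⟩ := hi
    rw [F.Y_comb hst, ha0, show v (0 + 1) = v 1 from rfl, hb0] at hA1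
    simp at hA1
  · rw [segment_symm] at hi
    exact main 1 0 (by decide) (by decide) (by decide) hb0 ha0 hi
  · exact main 0 1 (by decide) (by decide) (by decide) ha0 hb0 hi

theorem not_forall_Y_eq_one (hF : IsBaseFrame L F) {q : ℝ}
    (h : ∀ y ∈ L, q * (F.Y y - 1) ≤ 0) : q = 0 := by
  have h0 := h _ hF.zero_mem
  obtain ⟨y, hy, hy1⟩ := hF.exists_high
  have h1 := h y hy
  rw [F.Y_pt] at h0
  nlinarith

theorem eq_add_one_of_lt (hF : IsBaseFrame L F) (hP : IsFacetPolygon L W) {m n : ℤ}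
    (hm : F.pt m 1 ∈ L) (hn : F.pt n 1 ∈ L) (h : m < n) : n = m + 1 := by
  by_contra hne
  have hlt : m + 1 < n := by omega
  have hlt : (m : ℝ) + 1 < n := by exact_mod_cast hlt
  obtain ⟨p, q, hpq, hle⟩ := F.exists_support hP.convex hP.nonempty_interior (a := m + 1) (b := 1)
    fun h => hP.free _ h (by exact_mod_cast F.isIntPt_pt (m + 1) 1)
  have h1 := hle _ hm
  have h2 := hle _ hn
  rw [F.X_pt, F.Y_pt] at h1 h2
  have hp : p = 0 := by nlinarith
  subst hp
  simp only [zero_mul, zero_add] at hle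
  simp [hF.not_forall_Y_eq_one hle] at hpq

theorem isQ1 (hF : IsBaseFrame L F) (hP : IsFacetPolygon L W) (hcard : W.card = 4) {A B : Pt}
    (hA : A ∈ L) (hAi : IsIntPt A) (hA1 : F.Y A = 1) (hB : B ∈ L) (hBi : IsIntPt B)
    (hB1 : F.Y B = 1) (hAB : A ≠ B)
    (hall : ∀ z ∈ L, IsIntPt z → F.Y z = 1 → z = A ∨ z = B) : IsQ1 L := by
  obtain ⟨a, ha, b, hb, hab, ha0, hb0⟩ := hF.exists_base hP
  obtain ⟨v, hv, rfl, rfl⟩ := hP.exists_labeling_four_of_edge hcard ha hb hab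
    (neg_ne_zero.2 F.gradY_ne_zero) (ev_gradY_eq (hb0.trans ha0.symm)) (hF.gradY_le ha0)
  have hseg : ∀ z ∈ L, F.Y z = 0 → z ∈ segment ℝ (v 0) (v 1) := fun z hz hz0 =>
    hF.mem_segment hP ha hb hab ha0 hb0 hz hz0
  have hside0 : ∀ z ∈ segment ℝ (v 0) (v (0 + 1)), F.Y z = 0 := by
    rintro z ⟨s, t, -, -, hst, rfl⟩
    rw [F.Y_comb hst, ha0, show v (0 + 1) = v 1 from rfl, hb0]; ring
  obtain ⟨i, hi⟩ := hv.boundary A hA fun h => hP.free A h hAi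
  obtain ⟨j, hj⟩ := hv.boundary B hB fun h => hP.free B h hBi
  have hi0 : i ≠ 0 := by rintro rfl; simp [hside0 A hi] at hA1
  have hj0 : j ≠ 0 := by rintro rfl; simp [hside0 B hj] at hB1
  have hij : i ≠ j := by
    rintro rfl
    obtain ⟨g, hg, hle, he, -⟩ := hv.exists_side i
    have eA := IsCyclicLabeling.ev_eq_of_mem_segment he hi
    have eB := IsCyclicLabeling.ev_eq_of_mem_segment he hj
    have line : ∀ z, ev g z = ev g A + (F.Y z - 1) * ev g F.snd := by
      have e : ∀ z, ev g z = ev g F.origin + F.X z * ev g F.fst + F.Y z * ev g F.snd := fun z => by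
        conv_lhs => rw [← F.pt_X_Y z, LatticeFrame.pt, ev_add, ev_add, ev_smul, ev_smul]
      have h1 := e A
      have h2 := e B
      rw [hA1] at h1
      rw [hB1] at h2
      have hX : F.X A - F.X B ≠ 0 := fun h =>
        hAB (F.ext_pt (sub_eq_zero.1 h) (hA1.trans hB1.symm))
      have h3 : (F.X A - F.X B) * ev g F.fst = 0 := by linarith
      have h4 := (mul_eq_zero.1 h3).resolve_left hX
      intro z
      rw [e z, h1, h4]; ring
    have hs : ev g F.snd = 0 := hF.not_forall_Y_eq_one fun y hy => by
      have := hle y hy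
      rw [line y] at this
      linarith
    obtain ⟨w, hw, hne⟩ := hP.exists_ev_ne hg (ev g A)
    exact hne (by rw [line w, hs]; ring)
  obtain ⟨l, hl0, hli, hlj, hl⟩ := (by decide : ∀ i j : Fin 4, i ≠ 0 → j ≠ 0 → i ≠ j →
    ∃ l : Fin 4, l ≠ 0 ∧ l ≠ i ∧ l ≠ j ∧ ∀ m, m ≠ 0 → m ≠ l → m = i ∨ m = j) i j hi0 hj0 hij
  refine ⟨v, hv.isQuadWith hP, ⟨F.pt 0 0, F.pt 1 0, fun h => ?_, by exact_mod_cast F.isIntPt_pt 0 0,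
    by exact_mod_cast F.isIntPt_pt 1 0, hseg _ hF.zero_mem (by simp),
    hseg _ hF.one_mem (by simp)⟩, ⟨l, hl0, fun m hm0 hml => ?_, fun z hz hzi => ?_⟩, ?_⟩
  · have := congrArg F.X h
    simp at this
  · rcases hl m hm0 hml with rfl | rfl
    · exact ⟨A, hAi, hi⟩
    · exact ⟨B, hBi, hj⟩
  · have hzL := hv.segment_subset hP _ _ (openSegment_subset_segment _ _ _ hz)
    have hne : (1 + 1 : Fin 4) ≠ 0 := by decide
    rcases hF.Y_of_isIntPt hzL hzi with h0 | h1
    · exact hl0 (hv.eq_of_mem_openSegment hP hne hz (i := 0) (hseg z hzL h0)).symm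
    · rcases hall z hzL hzi h1 with rfl | rfl
      · exact hli (hv.eq_of_mem_openSegment hP hne hz hi).symm
      · exact hlj (hv.eq_of_mem_openSegment hP hne hz hj).symm
  · obtain ⟨C, hC⟩ := hP.exists_bound
    obtain ⟨T, hT, hsub⟩ := exists_isT1_of_bounded C
    exact ⟨T, Or.inl hT, fun x hx => hsub x (hC x hx)⟩

theorem card_le_of_forall (hF : IsBaseFrame L F) (hP : IsFacetPolygon L W) {Z : Finset Pt}
    (hZ : ∀ z ∈ Z, z ∈ L ∧ IsIntPt z) (hall : ∀ z ∈ L, IsIntPt z → F.Y z = 1 → z ∈ Z)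
    [DecidableEq Pt] : W.card ≤ (insert (F.pt 0 0) (insert (F.pt 1 0) Z)).card := by
  have hmem : ∀ x ∈ insert (F.pt 0 0) (insert (F.pt 1 0) Z), x ∈ L ∧ IsIntPt x := by
    intro x hx
    rw [Finset.mem_insert, Finset.mem_insert] at hx
    rcases hx with rfl | rfl | hx
    · exact ⟨hF.zero_mem, by exact_mod_cast F.isIntPt_pt 0 0⟩
    · exact ⟨hF.one_mem, by exact_mod_cast F.isIntPt_pt 1 0⟩
    · exact hZ x hx
  refine hP.card_le _ (fun x hx => (hmem x hx).1) (fun x hx h => hP.free x h (hmem x hx).2)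
    fun z hz hzi => ?_
  rcases hF.Y_of_isIntPt hz hzi with h0 | h1
  · refine Or.inr ⟨-F.gradY, neg_ne_zero.2 F.gradY_ne_zero, F.pt 0 0, by simp, F.pt 1 0, by simp,
      fun h => ?_, hF.gradY_le (by simp), ev_gradY_eq (by simp), ev_gradY_eq (by simp [h0])⟩
    have := congrArg F.X h
    simp at this
  · exact Or.inl (by simp [hall z hz hzi h1])

theorem classification (hF : IsBaseFrame L F) (hP : IsFacetPolygon L W) :
    IsT2A L ∨ IsT2B L ∨ IsQ1 L := by
  classical
  have h3 := hP.three_le_card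
  by_cases hA : ∃ A ∈ L, IsIntPt A ∧ F.Y A = 1
  swap
  · exfalso
    have := hF.card_le_of_forall hP (Z := ∅) (by simp) fun z hz hzi h1 =>
      (hA ⟨z, hz, hzi, h1⟩).elim
    have := this.trans Finset.card_le_two
    omega
  obtain ⟨A, hA, hAi, hA1⟩ := hA
  have htri : W.card = 3 → IsT2A L ∨ IsT2B L ∨ IsQ1 L := fun h =>
    (hF.isT2 hP h hA hAi hA1).elim Or.inl fun h => Or.inr (Or.inl h)
  by_cases hB : ∃ B ∈ L, IsIntPt B ∧ F.Y B = 1 ∧ A ≠ B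
  swap
  · push Not at hB
    have := hF.card_le_of_forall hP (Z := {A}) (by simp [hA, hAi]) fun z hz hzi h1 =>
      Finset.mem_singleton.2 (hB z hz hzi h1).symm
    have := this.trans Finset.card_le_three
    exact htri (by omega)
  obtain ⟨B, hB, hBi, hB1, hAB⟩ := hB
  have coord : ∀ z ∈ L, IsIntPt z → F.Y z = 1 → ∃ m : ℤ, z = F.pt m 1 := by
    intro z _ hzi hz1
    obtain ⟨m, n, rfl⟩ := F.exists_pt_of_isIntPt hzi
    rw [F.Y_pt] at hz1
    exact ⟨m, by rw [hz1]⟩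
  have hall : ∀ z ∈ L, IsIntPt z → F.Y z = 1 → z = A ∨ z = B := by
    intro z hz hzi hz1
    by_contra! hne
    obtain ⟨m, rfl⟩ := coord A hA hAi hA1
    obtain ⟨n, rfl⟩ := coord B hB hBi hB1
    obtain ⟨l, rfl⟩ := coord z hz hzi hz1
    have e1 : m ≠ n := fun h => hAB (by rw [h])
    have e2 : l ≠ m := fun h => hne.1 (by rw [h])
    have e3 : l ≠ n := fun h => hne.2 (by rw [h])
    have := hF.eq_add_one_of_lt hP hA hB
    have := hF.eq_add_one_of_lt hP hB hA
    have := hF.eq_add_one_of_lt hP hA hz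
    have := hF.eq_add_one_of_lt hP hz hA
    have := hF.eq_add_one_of_lt hP hB hz
    have := hF.eq_add_one_of_lt hP hz hB
    omega
  have hle := hF.card_le_of_forall hP (Z := {A, B}) (by simp [hA, hAi, hB, hBi])
    fun z hz hzi h1 => by simpa using hall z hz hzi h1
  have := hle.trans Finset.card_le_four
  have hcase : W.card = 3 ∨ W.card = 4 := by omega
  rcases hcase with h | h
  · exact htri h
  · exact Or.inr (Or.inr (hF.isQ1 hP h hA hAi hA1 hB hBi hB1 hAB hall))

end IsBaseFrame

/-- A polygon with long edges along both axes of a frame. -/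
theorem IsFacetPolygon.classification_of_corner {L : Set Pt} {W : Finset Pt}
    (hP : IsFacetPolygon L W) {F : LatticeFrame} (h00 : F.pt 0 0 ∈ L) (h10 : F.pt 1 0 ∈ L)
    (h01 : F.pt 0 1 ∈ L) (h02 : F.pt 0 2 ∈ L) (hY : ∀ y ∈ L, 0 ≤ F.Y y) :
    (∃ T, IsSplitSet T ∧ L ⊆ T) ∨ IsT1 L ∨ IsT2A L ∨ IsT2B L ∨ IsQ1 L := by
  have hX : ∀ y ∈ L, 0 ≤ F.X y := by
    obtain ⟨p, q, hpq, hle⟩ := F.exists_support hP.convex hP.nonempty_interior (a := 0) (b := 1)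
      fun h => hP.free _ h (by exact_mod_cast F.isIntPt_pt 0 1)
    have h1 := hle _ h00
    have h2 := hle _ h02
    have h3 := hle _ h10
    simp only [F.X_pt, F.Y_pt] at h1 h2 h3
    have hq : q = 0 := by linarith
    subst hq
    have hp : p < 0 := lt_of_le_of_ne (by linarith) (by simpa using hpq)
    intro y hy
    have := hle y hy
    nlinarith
  obtain ⟨p, q, hpq, hle⟩ := F.exists_support hP.convex hP.nonempty_interior (a := 1) (b := 1)
    fun h => hP.free _ h (by exact_mod_cast F.isIntPt_pt 1 1)
  have h1 := hle _ h10
  have h2 := hle _ h01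
  have h3 := hle _ h02
  simp only [F.X_pt, F.Y_pt] at h1 h2 h3
  have hq : 0 ≤ q := by linarith
  have hp : 0 < p := by
    refine lt_of_le_of_ne (by linarith) fun h => ?_
    subst h
    have : q = 0 := by linarith
    simp [this] at hpq
  by_cases h20 : F.pt 2 0 ∈ L
  · have h4 := hle _ h20
    simp only [F.X_pt, F.Y_pt] at h4
    obtain rfl : p = q := by linarith
    right; left
    convert F.isT1 using 1
    refine Set.Subset.antisymm (fun x hx => ?_) (convexHull_min ?_ hP.convex)
    · rw [← F.pt_X_Y x]
      refine mem_convexHull_triangle (hX x hx) (hY x hx) ?_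
      have := hle x hx
      nlinarith
    · rintro _ ⟨i, rfl⟩
      fin_cases i
      · simpa [LatticeFrame.pt] using h00
      · simpa [LatticeFrame.pt] using h20
      · simpa [LatticeFrame.pt] using h02
  by_cases hhigh : ∃ y ∈ L, 1 < F.X y
  swap
  · push Not at hhigh
    exact Or.inl ⟨_, F.swap.isSplitSet_strip, fun y hy => by
      simpa [F.swap_Y] using ⟨hX y hy, hhigh y hy⟩⟩
  have hF : IsBaseFrame L F.swap := by
    refine ⟨by rwa [F.swap_pt], by rwa [F.swap_pt], fun y hy => by rw [F.swap_Y]; exact hX y hy,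
      fun m n hmn => ?_, by simpa only [F.swap_Y] using hhigh⟩
    rw [F.swap_pt] at hmn
    by_contra! hn
    have h4 := hle _ hmn
    have h5 := hY _ hmn
    simp only [F.X_pt, F.Y_pt] at h4 h5
    have hn' : (1 : ℝ) + 1 ≤ n := by exact_mod_cast hn
    have hm0 : q * m ≤ 0 := by nlinarith
    have e1 : (n : ℝ) = 2 := by nlinarith
    have e2 : p = q := by nlinarith
    have e3 : (m : ℝ) = 0 := by subst e2; nlinarith
    exact h20 (by rwa [e1, e3] at hmn)
  rcases hF.classification hP with h | h | h
  · exact Or.inr (Or.inr (Or.inl h))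
  · exact Or.inr (Or.inr (Or.inr (Or.inl h)))
  · exact Or.inr (Or.inr (Or.inr (Or.inr h)))

theorem IsFacetPolygon.classification_of_hasLongEdge {L : Set Pt} {W : Finset Pt}
    (hP : IsFacetPolygon L W) (hlong : HasLongEdge L) :
    (∃ T, IsSplitSet T ∧ L ⊆ T) ∨ IsT1 L ∨ IsT2A L ∨ IsT2B L ∨ IsQ1 L := by
  obtain ⟨F, h00, h10, hY⟩ := hlong.exists_frame hP.convex
  by_cases hhigh : ∃ y ∈ L, 1 < F.Y y
  swap
  · push Not at hhigh
    exact Or.inl ⟨_, F.isSplitSet_strip, fun y hy => ⟨hY y hy, hhigh y hy⟩⟩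
  by_cases hno : ∀ m n : ℤ, F.pt m n ∈ L → n ≤ 1
  · rcases IsBaseFrame.classification ⟨h00, h10, hY, hno, hhigh⟩ hP with h | h | h
    · exact Or.inr (Or.inr (Or.inl h))
    · exact Or.inr (Or.inr (Or.inr (Or.inl h)))
    · exact Or.inr (Or.inr (Or.inr (Or.inr h)))
  push Not at hno
  obtain ⟨m, n, hmn, hn⟩ := hno
  have hn2 : (2 : ℝ) ≤ n := by exact_mod_cast hn
  have key : ∀ (G : LatticeFrame) (c : ℤ), G.pt 0 0 ∈ L → G.pt 1 0 ∈ L →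
      (∀ y ∈ L, 0 ≤ G.Y y) → G.pt (c * n) n ∈ L →
      (∃ T, IsSplitSet T ∧ L ⊆ T) ∨ IsT1 L ∨ IsT2A L ∨ IsT2B L ∨ IsQ1 L := by
    intro G c h00 h10 hY hc
    have hmem : ∀ t : ℝ, 0 ≤ t → t ≤ n → (G.shear c).pt 0 t ∈ L := by
      intro t ht htn
      have := hP.convex h00 hc (a := 1 - t / n) (b := t / n)
        (sub_nonneg.2 (div_le_one_of_le₀ htn (by linarith))) (by positivity) (by ring)
      rw [G.pt_comb (by ring)] at this
      rw [G.shear_pt]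
      convert this using 2 <;> field_simp <;> ring
    exact hP.classification_of_corner (F := G.shear c) (hmem 0 le_rfl (by linarith))
      (by rw [G.shear_pt]; simpa using h10) (hmem 1 zero_le_one (by linarith))
      (hmem 2 zero_le_two hn2) fun y hy => by rw [G.shear_Y]; exact hY y hy
  obtain ⟨c, hc1, hc2⟩ : ∃ c : ℤ, m ≤ c * n ∧ c * n ≤ m + n - 1 := by
    refine ⟨(m + n - 1) / n, ?_, Int.ediv_mul_le _ (by omega)⟩
    have := Int.lt_ediv_add_one_mul_self (m + n - 1) (show 0 < n by omega)
    linarith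
  rcases hc1.eq_or_lt with h | hc1
  · exact key F c h00 h10 hY (by rw [h] at hmn; exact_mod_cast hmn)
  rcases hc2.eq_or_lt with h | hc2
  · refine key F.flip (1 - c) (by rw [F.flip_pt]; simpa using h10)
      (by rw [F.flip_pt]; simpa using h00) (fun y hy => by rw [F.flip_Y]; exact hY y hy) ?_
    rw [F.flip_pt]
    convert hmn using 2
    have h : (c : ℝ) * n = m + n - 1 := by exact_mod_cast h
    push_cast
    linear_combination h
  exfalso
  obtain ⟨p, q, hpq, hle⟩ := F.exists_support hP.convex hP.nonempty_interior (a := c) (b := 1)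
    fun h => hP.free _ h (by exact_mod_cast F.isIntPt_pt c 1)
  have e1 := hle _ h00
  have e2 := hle _ h10
  have e3 := hle _ hmn
  simp only [F.X_pt, F.Y_pt] at e1 e2 e3
  have hc1 : 0 < (c : ℝ) * n - m := by
    have : (m : ℝ) < c * n := by exact_mod_cast hc1
    linarith
  have hc2 : 0 < (m : ℝ) + n - 1 - c * n := by
    have : (c : ℝ) * n < m + n - 1 := by exact_mod_cast hc2
    linarith
  have f1 := mul_nonpos_of_nonneg_of_nonpos hc2.le e1
  have f2 := mul_nonpos_of_nonneg_of_nonpos hc1.le e2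
  have g1 := (mul_eq_zero.1 (show ((m : ℝ) + n - 1 - c * n) * (p * (0 - c) + q * (0 - 1)) = 0 by
    linarith)).resolve_left hc2.ne'
  have g2 := (mul_eq_zero.1 (show ((c : ℝ) * n - m) * (p * (1 - c) + q * (0 - 1)) = 0 by
    linarith)).resolve_left hc1.ne'
  have hp : p = 0 := by linarith
  have hq : q = 0 := by rw [hp] at g1; linarith
  exact hpq.elim (fun h => h hp) fun h => h hq

theorem facet_classification (k : ℕ)
    (hk : 1 ≤ k)
    (r : Fin k → Pt) (f : Pt)
    (hr_rat : ∀ i, IsRatPt (r i)) (hr_ne : ∀ i, r i ≠ 0)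
    (hf_rat : IsRatPt f) (hf_int : ¬ IsIntPt f)
    (hne : (mixedP k r f).Nonempty)
    (α : Fin k → ℝ) (hα : ∀ i, 0 ≤ α i)
    (hfacet : IsFacet k r f α 1)
    (hcone : coneGen (Set.range r) = Set.univ) :
    f ∈ interior (inducedSet k r f α) ∧
    ((∃ T : Set Pt, IsSplitSet T ∧ inducedSet k r f α ⊆ T) ∨
      IsT1 (inducedSet k r f α) ∨ IsT2A (inducedSet k r f α) ∨
      IsT2B (inducedSet k r f α) ∨ IsT3 (inducedSet k r f α) ∨
      IsQ1 (inducedSet k r f α) ∨ IsQ2 (inducedSet k r f α)) := by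
  refine ⟨mem_interior_inducedSet hα hcone, ?_⟩
  by_cases h0 : ∃ i, α i = 0
  · obtain ⟨i, hi⟩ := h0
    refine Or.inl (exists_splitSet_of_recession (convex_inducedSet k r f α)
      (mem_interior_inducedSet hα hcone)
      (fun x hx => not_isIntPt_of_mem_interior_inducedSet hα hfacet.1 hx) (hr_ne i) (hr_rat i)
      fun x hx t ht => ?_)
    rw [mem_inducedSet_iff hα] at hx ⊢
    obtain ⟨s, hs, hsum, rfl⟩ := hx
    refine ⟨s + Pi.single i t, fun j => add_nonneg (hs j) ?_, ?_, ?_⟩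
    · by_cases hj : j = i
      · subst hj; simpa using ht
      · simp [hj]
    · simpa [mul_add, Finset.sum_add_distrib, Pi.single_apply, hi] using hsum
    · simp [add_smul, Finset.sum_add_distrib, Pi.single_apply, ite_smul, add_assoc]
  · push Not at h0
    obtain ⟨W, hP⟩ := hfacet.exists_isFacetPolygon hr_rat hne hcone
      fun i => lt_of_le_of_ne (hα i) (h0 i).symm
    by_cases hlong : HasLongEdge (inducedSet k r f α)
    · rcases hP.classification_of_hasLongEdge hlong with h | h
      · exact Or.inl h
      · tauto
    · rcases hP.isT3_or_isQ2 hlong with h | h <;> tauto
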